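/- Under the Setup, for every m with 0 ≤ m ≤ M+1: the functions F_m and G_m are non-constant, and there exists a meromorphic function K_m on ℂ with only finitely many zeros and finitely many poles such that F_m' = (f^{(m)} f^{(m+2)})/(f^{(m+1)})² = K_m · (g^{(m)} g^{(m+2)})/(g^{(m+1)})² = K_m G_m'. Moreover |K_m(x)| = 1 for all real x, and there exist a rational function R_m and a real number a_m such that K_m(z) = R_m(z)·e^{i a_m z}. -/

import Mathlib

open Complex Filter Topology MeasureTheory
open scoped Classical

noncomputable section

/-- `mtilde f` is the function `z ↦ conj (f (conj z))`, denoted `f̃` in the paper. -/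
def mtilde (f : ℂ → ℂ) : ℂ → ℂ := fun z => (starRingEnd ℂ) (f ((starRingEnd ℂ) z))

/-- Equality of meromorphic functions: near every point of `ℂ`, the two functions agree on a
punctured neighbourhood (so the set where they disagree is closed and discrete). -/
def MeroEq (h₁ h₂ : ℂ → ℂ) : Prop := ∀ z : ℂ, ∀ᶠ w in 𝓝[≠] z, h₁ w = h₂ w

/-- `f` is strictly non-real: `f̃` is not a constant multiple of `f`. -/
def StrictlyNonReal (f : ℂ → ℂ) : Prop := ¬ ∃ c : ℂ, MeroEq (mtilde f) (fun z => c * f z)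

/-- A rational function, as a meromorphic function on `ℂ`. -/
def IsRatFn (h : ℂ → ℂ) : Prop :=
  ∃ p q : Polynomial ℂ, q ≠ 0 ∧ MeroEq h (fun z => p.eval z / q.eval z)

/-- The order of vanishing (negative at a pole) of a function at a point, when the function is
meromorphic there; junk value `0` otherwise. -/
def meroOrder (h : ℂ → ℂ) (z : ℂ) : WithTop ℤ :=
  if hh : MeromorphicAt h z then meromorphicOrderAt h z else 0

/-- The positive part of the logarithm. -/
def logPlus (x : ℝ) : ℝ := max (Real.log x) 0

/-- The Nevanlinna proximity function `m(r, h)`. -/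
def proximity (h : ℂ → ℂ) (r : ℝ) : ℝ :=
  (2 * Real.pi)⁻¹ * ∫ θ in (0:ℝ)..(2 * Real.pi),
    logPlus ‖h ((r : ℂ) * Complex.exp (θ * Complex.I))‖

/-- The multiplicity of a pole of `h` at `z` (0 if not a pole). -/
def poleMult (h : ℂ → ℂ) (z : ℂ) : ℕ := (-((meroOrder h z).untopD 0)).toNat

/-- The number of poles, counted with multiplicity, in the closed disc of radius `t`. -/
def poleCount (h : ℂ → ℂ) (t : ℝ) : ℝ := ∑ᶠ z ∈ Metric.closedBall (0:ℂ) t, (poleMult h z : ℝ)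

/-- The integrated counting function `N(r, h)` of the poles of `h` (with multiplicity). -/
def NCount (h : ℂ → ℂ) (r : ℝ) : ℝ := ∫ t in (1:ℝ)..r, poleCount h t / t

/-- The Nevanlinna characteristic `T(r, h) = m(r, h) + N(r, h)`. -/
def TChar (h : ℂ → ℂ) (r : ℝ) : ℝ := proximity h r + NCount h r

/-- The number of points of `S` in the closed disc of radius `t`. -/
def distinctCount (S : Set ℂ) (t : ℝ) : ℝ := (S ∩ Metric.closedBall (0:ℂ) t).ncard

/-- The integrated counting function `N̄(r, h)` of the distinct poles of `h`. -/
def NbarPoles (h : ℂ → ℂ) (r : ℝ) : ℝ :=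
  ∫ t in (1:ℝ)..r, distinctCount {z | meroOrder h z < 0} t / t

/-- The integrated counting function `N̄(r, 1/h)` of the distinct zeros of `h`. -/
def NbarZeros (h : ℂ → ℂ) (r : ℝ) : ℝ :=
  ∫ t in (1:ℝ)..r, distinctCount {z | 0 < meroOrder h z} t / t

/-- `h` has finite (Nevanlinna) order: `T(r, h) ≤ r ^ C` for all large `r`. -/
def FiniteOrder (h : ℂ → ℂ) : Prop := ∃ C : ℝ, ∀ᶠ r in atTop, TChar h r ≤ r ^ C

/-- `h` has finite lower order: `T(r, h) ≤ r ^ C` for arbitrarily large `r`. -/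
def FiniteLowerOrder (h : ℂ → ℂ) : Prop := ∃ C : ℝ, ∃ᶠ r in atTop, TChar h r ≤ r ^ C

/-- The Setup of Section 3 of the paper: `M ≥ 4` and `f` is a strictly non-real meromorphic
function in the plane such that `f, f', …, f^(M+3)` all have finitely many non-real zeros. -/
def Setup (M : ℕ) (f : ℂ → ℂ) : Prop :=
  4 ≤ M ∧ (∀ z, MeromorphicAt f z) ∧ StrictlyNonReal f ∧
    ∀ m, m ≤ M + 3 → {z : ℂ | 0 < meroOrder (iteratedDeriv m f) z ∧ z.im ≠ 0}.Finite

/-- The function `F_m(z) = z - f^(m)(z) / f^(m+1)(z)`. -/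
def Fm (f : ℂ → ℂ) (m : ℕ) : ℂ → ℂ :=
  fun z => z - iteratedDeriv m f z / iteratedDeriv (m + 1) f z

/-- `Km` is the meromorphic function with finitely many zeros and poles satisfying
`F_m' = K_m G_m'`, where `G_m` is the analogue of `F_m` for `g = f̃`. -/
def IsKm (f : ℂ → ℂ) (m : ℕ) (Km : ℂ → ℂ) : Prop :=
  (∀ z, MeromorphicAt Km z) ∧ {z | 0 < meroOrder Km z}.Finite ∧
    {z | meroOrder Km z < 0}.Finite ∧
    MeroEq (deriv (Fm f m)) (fun z => Km z * deriv (Fm (mtilde f) m) z)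

end


/-! ### Part 1: logarithms and Schwarz type lemmas -/

theorem s9_exists_log_aux {U : Set ℂ} (hU : IsOpen U) (hc : IsPreconnected U) {g : ℂ → ℂ}
    (hg : DifferentiableOn ℂ g U) (h0 : ∀ z ∈ U, g z ≠ 0) {c : ℂ} (hcU : c ∈ U)
    {F : ℂ → ℂ} (hFc : F c = Complex.log (g c))
    (hF : ∀ z ∈ U, HasDerivAt F (deriv g z / g z) z) :
    ∀ z ∈ U, Complex.exp (F z) = g z := by
  have key : ∀ z ∈ U, HasDerivAt (fun w => g w * Complex.exp (-F w)) 0 z := by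
    intro z hz
    have h1 : HasDerivAt g (deriv g z) z := (hg.differentiableAt (hU.mem_nhds hz)).hasDerivAt
    have h2 := h1.mul (hF z hz).neg.cexp
    have hne := h0 z hz
    have e : deriv g z * Complex.exp (-F z) +
        g z * (Complex.exp (-F z) * -(deriv g z / g z)) = 0 := by
      field_simp
      ring
    rw [← e]
    exact h2
  have hconst : ∀ z ∈ U, g z * Complex.exp (-F z) = g c * Complex.exp (-F c) := by
    intro z hz
    refine hU.is_const_of_deriv_eq_zero hc (f := fun w => g w * Complex.exp (-F w)) ?_ ?_ hz hcU
    · intro w hw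
      exact (key w hw).differentiableAt.differentiableWithinAt
    · intro w hw
      exact (key w hw).deriv
  intro z hz
  have h := hconst z hz
  rw [hFc, Complex.exp_neg (Complex.log _), Complex.exp_log (h0 c hcU),
    mul_inv_cancel₀ (h0 c hcU), Complex.exp_neg] at h
  have := Complex.exp_ne_zero (F z)
  field_simp at h
  exact h.symm

theorem s9_exists_log_ball {g : ℂ → ℂ} {c : ℂ} {r : ℝ} (hr : 0 < r)
    (hg : DifferentiableOn ℂ g (Metric.ball c r)) (h0 : ∀ z ∈ Metric.ball c r, g z ≠ 0) :
    ∃ F : ℂ → ℂ, (∀ z ∈ Metric.ball c r, HasDerivAt F (deriv g z / g z) z) ∧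
      ∀ z ∈ Metric.ball c r, Complex.exp (F z) = g z := by
  have hd : DifferentiableOn ℂ (fun z => deriv g z / g z) (Metric.ball c r) :=
    (hg.deriv Metric.isOpen_ball).div hg h0
  obtain ⟨F, hF, hFc⟩ := hd.isExactOn_ball.with_val_at c (Complex.log (g c))
  refine ⟨F, hFc, ?_⟩
  exact s9_exists_log_aux Metric.isOpen_ball (convex_ball c r).isPreconnected hg h0
    (Metric.mem_ball_self hr) hF hFc

theorem s9_exists_log_entire {g : ℂ → ℂ} (hg : Differentiable ℂ g) (h0 : ∀ z, g z ≠ 0) :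
    ∃ F : ℂ → ℂ, Differentiable ℂ F ∧ ∀ z, Complex.exp (F z) = g z := by
  have hd : Differentiable ℂ (fun z => deriv g z / g z) :=
    fun z => ((hg.differentiableOn.deriv isOpen_univ).differentiableAt Filter.univ_mem).div
      (hg z) (h0 z)
  obtain ⟨F, hF, hFc⟩ := hd.isExactOn_univ.with_val_at 0 (Complex.log (g 0))
  refine ⟨F, fun z => (hFc z trivial).differentiableAt, ?_⟩
  intro z
  exact s9_exists_log_aux isOpen_univ isPreconnected_univ hg.differentiableOn (fun z _ => h0 z)
    (Set.mem_univ 0) hF hFc z trivial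

/-- Schwarz lemma for functions with positive real part. -/
theorem s9_schwarz_re {φ : ℂ → ℂ} {c : ℂ} {ρ : ℝ}
    (hφ : DifferentiableOn ℂ φ (Metric.ball c ρ)) (hpos : ∀ z ∈ Metric.ball c ρ, 0 < (φ z).re)
    {z : ℂ} (hz : z ∈ Metric.ball c ρ) :
    ‖φ z - φ c‖ ≤ ‖z - c‖ / ρ * ‖φ z + (starRingEnd ℂ) (φ c)‖ := by
  have hρ : 0 < ρ := Metric.nonempty_ball.1 ⟨z, hz⟩
  have hc : c ∈ Metric.ball c ρ := Metric.mem_ball_self hρ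
  have hne : ∀ w ∈ Metric.ball c ρ, φ w + (starRingEnd ℂ) (φ c) ≠ 0 := by
    intro w hw h
    have := congrArg Complex.re h
    simp at this
    linarith [hpos w hw, hpos c hc]
  set q : ℂ → ℂ := fun w => (φ w - φ c) / (φ w + (starRingEnd ℂ) (φ c)) with hq
  have hqd : DifferentiableOn ℂ q (Metric.ball c ρ) :=
    (hφ.sub_const _).div (hφ.add_const _) hne
  have hqc : q c = 0 := by simp [hq]
  have hm : Set.MapsTo q (Metric.ball c ρ) (Metric.closedBall (q c) 1) := by
    intro w hw
    rw [hqc, mem_closedBall_zero_iff, hq]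
    simp only [norm_div]
    rw [div_le_one (norm_pos_iff.2 (hne w hw))]
    rw [← sq_le_sq₀ (norm_nonneg _) (norm_nonneg _), ← Complex.normSq_eq_norm_sq,
      ← Complex.normSq_eq_norm_sq, Complex.normSq_apply, Complex.normSq_apply]
    simp
    nlinarith [hpos w hw, hpos c hc, mul_pos (hpos w hw) (hpos c hc)]
  have := Complex.dist_le_div_mul_dist_of_mapsTo_ball hqd hm hz
  rw [hqc, dist_zero_right, dist_eq_norm, hq] at this
  simp only [norm_div] at this
  rw [div_le_iff₀ (norm_pos_iff.2 (hne z hz))] at this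
  calc _ ≤ _ := this
    _ = _ := by ring

theorem s9_deriv_center {φ : ℂ → ℂ} {c : ℂ} {ρ : ℝ} (hρ : 0 < ρ)
    (hφ : DifferentiableOn ℂ φ (Metric.ball c ρ)) (hpos : ∀ z ∈ Metric.ball c ρ, 0 < (φ z).re) :
    ‖deriv φ c‖ ≤ 2 * (φ c).re / ρ := by
  have hc : c ∈ Metric.ball c ρ := Metric.mem_ball_self hρ
  have hd : HasDerivAt φ (deriv φ c) c :=
    (hφ.differentiableAt (Metric.isOpen_ball.mem_nhds hc)).hasDerivAt
  have h1 : Tendsto (fun z => ‖slope φ c z‖) (𝓝[≠] c) (𝓝 ‖deriv φ c‖) :=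
    (hasDerivAt_iff_tendsto_slope.1 hd).norm
  have h2 : Tendsto (fun z => ‖φ z + (starRingEnd ℂ) (φ c)‖ / ρ) (𝓝[≠] c)
      (𝓝 (‖φ c + (starRingEnd ℂ) (φ c)‖ / ρ)) :=
    (((hd.continuousAt.tendsto.mono_left nhdsWithin_le_nhds).add_const _).norm).div_const _
  have h3 : ‖φ c + (starRingEnd ℂ) (φ c)‖ / ρ = 2 * (φ c).re / ρ := by
    rw [Complex.add_conj, Complex.norm_real, Real.norm_of_nonneg (by linarith [hpos c hc])]
  rw [← h3]
  refine le_of_tendsto_of_tendsto h1 h2 ?_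
  filter_upwards [self_mem_nhdsWithin, mem_nhdsWithin_of_mem_nhds (Metric.ball_mem_nhds c hρ)]
    with z hzc hz
  have hzc' : 0 < ‖z - c‖ := norm_pos_iff.2 (sub_ne_zero.2 hzc)
  have := s9_schwarz_re hφ hpos hz
  rw [slope_def_field, norm_div, div_le_iff₀ hzc']
  calc _ ≤ _ := this
    _ = _ := by ring

theorem s9_harnack_lower {φ : ℂ → ℂ} {c : ℂ} {ρ : ℝ}
    (hφ : DifferentiableOn ℂ φ (Metric.ball c ρ)) (hpos : ∀ z ∈ Metric.ball c ρ, 0 < (φ z).re)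
    {z : ℂ} (hz : z ∈ Metric.ball c ρ) :
    (φ c).re * (ρ - ‖z - c‖) ≤ (φ z).re * (ρ + ‖z - c‖) := by
  have hρ : 0 < ρ := Metric.nonempty_ball.1 ⟨z, hz⟩
  have hc : c ∈ Metric.ball c ρ := Metric.mem_ball_self hρ
  have h := s9_schwarz_re hφ hpos hz
  set s := ‖z - c‖ / ρ with hs
  have hs0 : 0 ≤ s := by positivity
  have hs1 : s < 1 := by
    rw [hs, div_lt_one hρ]; simpa [dist_eq_norm] using hz
  have hzs : ‖z - c‖ = s * ρ := by rw [hs]; field_simp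
  rw [hzs]
  have ha := hpos c hc
  have hb := hpos z hz
  -- square
  have h2 : ‖φ z - φ c‖ ^ 2 ≤ s ^ 2 * ‖φ z + (starRingEnd ℂ) (φ c)‖ ^ 2 := by
    rw [← mul_pow]
    exact pow_le_pow_left₀ (norm_nonneg _) h 2
  rw [← Complex.normSq_eq_norm_sq, ← Complex.normSq_eq_norm_sq, Complex.normSq_apply,
    Complex.normSq_apply] at h2
  simp at h2
  set a := (φ c).re
  set b := (φ z).re
  set t := (φ z).im - (φ c).im
  have h3 : (b - a) ^ 2 ≤ s ^ 2 * (b + a) ^ 2 := by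
    have e : (φ z).im + -(φ c).im = t := by ring
    rw [e] at h2
    nlinarith [mul_nonneg (show (0:ℝ) ≤ 1 - s ^ 2 by nlinarith) (sq_nonneg t)]
  have h4 : a - b ≤ s * (b + a) := by
    have : |b - a| ≤ |s * (b + a)| := by
      apply sq_le_sq.1; rw [mul_pow]; exact h3
    rw [abs_of_nonneg (by positivity : 0 ≤ s * (b + a))] at this
    linarith [neg_abs_le (b - a)]
  nlinarith

theorem s9_deriv_noncentral {φ : ℂ → ℂ} {c : ℂ} {ρ : ℝ}
    (hφ : DifferentiableOn ℂ φ (Metric.ball c ρ)) (hpos : ∀ z ∈ Metric.ball c ρ, 0 < (φ z).re)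
    {z : ℂ} (hz : z ∈ Metric.ball c ρ) :
    ‖deriv φ z‖ * (ρ ^ 2 - ‖z - c‖ ^ 2) ≤ 2 * ρ * (φ z).re := by
  have hρ : 0 < ρ := Metric.nonempty_ball.1 ⟨z, hz⟩
  set ζ : ℂ := (z - c) / ρ with hζ
  have hzn : ‖z - c‖ < ρ := by simpa [dist_eq_norm] using hz
  have hρc : (ρ : ℂ) ≠ 0 := by exact_mod_cast hρ.ne'
  have hζn : ‖ζ‖ = ‖z - c‖ / ρ := by
    rw [hζ, norm_div, Complex.norm_real, Real.norm_of_nonneg hρ.le]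
  have hζ1 : ‖ζ‖ < 1 := by rw [hζn, div_lt_one hρ]; exact hzn
  set Mo : ℂ → ℂ := fun w => c + ρ * ((w + ζ) / (1 + (starRingEnd ℂ) ζ * w)) with hMo
  have hden : ∀ w ∈ Metric.ball (0:ℂ) 1, 1 + (starRingEnd ℂ) ζ * w ≠ 0 := by
    intro w hw h
    have h1 : ‖(starRingEnd ℂ) ζ * w‖ = 1 := by
      have : (starRingEnd ℂ) ζ * w = -1 := by linear_combination h
      rw [this]; simp
    rw [norm_mul, RCLike.norm_conj] at h1
    have hw' : ‖w‖ < 1 := by simpa using hw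
    nlinarith [norm_nonneg ζ, norm_nonneg w]
  have hMd : DifferentiableOn ℂ Mo (Metric.ball 0 1) := by
    intro w hw
    have := hden w hw
    apply DifferentiableAt.differentiableWithinAt
    rw [hMo]
    fun_prop (disch := assumption)
  have hMm : Set.MapsTo Mo (Metric.ball 0 1) (Metric.ball c ρ) := by
    intro w hw
    have hw' : ‖w‖ < 1 := by simpa using hw
    have hd := hden w hw
    rw [Metric.mem_ball, dist_eq_norm, hMo]
    simp only [add_sub_cancel_left, norm_mul, norm_div, Complex.norm_real,
      Real.norm_of_nonneg hρ.le]
    have : ‖w + ζ‖ < ‖1 + (starRingEnd ℂ) ζ * w‖ := by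
      rw [← sq_lt_sq₀ (norm_nonneg _) (norm_nonneg _), ← Complex.normSq_eq_norm_sq,
        ← Complex.normSq_eq_norm_sq]
      have e1 : Complex.normSq ζ < 1 := by
        rw [Complex.normSq_eq_norm_sq]; nlinarith [norm_nonneg ζ]
      have e2 : Complex.normSq w < 1 := by
        rw [Complex.normSq_eq_norm_sq]; nlinarith [norm_nonneg w]
      rw [Complex.normSq_apply] at *
      rw [Complex.normSq_apply]
      simp
      nlinarith [mul_pos (sub_pos.2 e1) (sub_pos.2 e2)]
    have h2 : ‖w + ζ‖ / ‖1 + (starRingEnd ℂ) ζ * w‖ < 1 := by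
      rw [div_lt_one (norm_pos_iff.2 hd)]; exact this
    nlinarith
  have hM0 : Mo 0 = z := by
    simp only [hMo, hζ]; field_simp; ring
  have hMder : HasDerivAt Mo (ρ * (1 - ζ * (starRingEnd ℂ) ζ)) 0 := by
    have h1 : HasDerivAt (fun w : ℂ => w + ζ) 1 0 := (hasDerivAt_id 0).add_const ζ
    have h2 : HasDerivAt (fun w : ℂ => 1 + (starRingEnd ℂ) ζ * w) ((starRingEnd ℂ) ζ) 0 := by
      simpa using ((hasDerivAt_id (0:ℂ)).const_mul ((starRingEnd ℂ) ζ)).const_add 1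
    have h3 := ((h1.div h2 (by simp)).const_mul (ρ:ℂ)).const_add c
    have e : (ρ : ℂ) * (1 - ζ * (starRingEnd ℂ) ζ) = ρ * ((1 * (1 + (starRingEnd ℂ) ζ * 0) -
        (0 + ζ) * (starRingEnd ℂ) ζ) / (1 + (starRingEnd ℂ) ζ * 0) ^ 2) := by
      simp
    rw [e]
    exact h3
  have hcomp := s9_deriv_center (φ := φ ∘ Mo) (c := 0) one_pos (hφ.comp hMd hMm)
    (fun w hw => hpos _ (hMm hw))
  have hφz : HasDerivAt φ (deriv φ z) (Mo 0) := by
    rw [hM0]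
    exact (hφ.differentiableAt (Metric.isOpen_ball.mem_nhds hz)).hasDerivAt
  rw [(hφz.comp 0 hMder).deriv] at hcomp
  simp only [Function.comp_apply, hM0, norm_mul, Complex.norm_real, Real.norm_of_nonneg hρ.le,
    div_one] at hcomp
  have e : ‖1 - ζ * (starRingEnd ℂ) ζ‖ = 1 - ‖z - c‖ ^ 2 / ρ ^ 2 := by
    rw [Complex.mul_conj, Complex.normSq_eq_norm_sq]
    rw [← Complex.ofReal_one, ← Complex.ofReal_sub, Complex.norm_real, Real.norm_of_nonneg, hζn,
      div_pow]
    nlinarith [norm_nonneg ζ]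
  rw [e] at hcomp
  calc ‖deriv φ z‖ * (ρ ^ 2 - ‖z - c‖ ^ 2)
      = ρ * (‖deriv φ z‖ * (ρ * (1 - ‖z - c‖ ^ 2 / ρ ^ 2))) := by field_simp
    _ ≤ ρ * (2 * (φ z).re) := by gcongr
    _ = _ := by ring


/-! ### Part 2: a Hopf type growth step -/

theorem s9_hopf {u : ℂ → ℂ} {w0 : ℂ} {s Λ D : ℝ} (hΛ : 0 < Λ) (hD0 : 0 ≤ D)
    (hu : DifferentiableOn ℂ u (Metric.ball w0 (2 * s))) (h0 : ‖u w0‖ ≤ Λ)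
    (hD : ∀ w ∈ Metric.ball w0 (2 * s), ‖u w‖ = Λ → ‖deriv u w‖ ≤ D)
    {z : ℂ} (hz : z ∈ Metric.ball w0 s) :
    ‖u z‖ ≤ Λ * Real.exp (2 * D * dist z w0 / Λ) := by
  by_cases hle : ‖u z‖ ≤ Λ
  · have : 1 ≤ Real.exp (2 * D * dist z w0 / Λ) := by
      apply Real.one_le_exp; positivity
    nlinarith
  push Not at hle
  have hsub : Metric.closedBall z (dist z w0) ⊆ Metric.ball w0 (2 * s) := by
    intro w hw
    have h1 : dist w z ≤ dist z w0 := hw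
    have h2 : dist z w0 < s := hz
    have := dist_triangle w z w0
    rw [Metric.mem_ball]; linarith
  have hcont : ContinuousOn (fun w => ‖u w‖) (Metric.closedBall z (dist z w0)) :=
    (hu.continuousOn.mono hsub).norm
  have hS : IsCompact (Metric.closedBall z (dist z w0) ∩ (fun w => ‖u w‖) ⁻¹' Set.Iic Λ) :=
    (isCompact_closedBall z _).of_isClosed_subset
      (hcont.preimage_isClosed_of_isClosed Metric.isClosed_closedBall isClosed_Iic)
      Set.inter_subset_left
  have hw0S : w0 ∈ Metric.closedBall z (dist z w0) ∩ (fun w => ‖u w‖) ⁻¹' Set.Iic Λ :=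
    ⟨by simp [dist_comm], h0⟩
  obtain ⟨p, ⟨hp1, hp2⟩, hpmin⟩ := hS.exists_isMinOn ⟨w0, hw0S⟩
    (f := fun w => dist w z) (by fun_prop)
  set d := dist p z with hd
  have hp2' : ‖u p‖ ≤ Λ := hp2
  have hdle : d ≤ dist z w0 := hp1
  have hpz : p ≠ z := by
    rintro rfl; linarith
  have hdpos : 0 < d := dist_pos.2 hpz
  have hbig : ∀ w ∈ Metric.ball z d, Λ < ‖u w‖ := by
    intro w hw
    by_contra hcon
    push Not at hcon
    have hw' : dist w z < d := hw
    have : w ∈ Metric.closedBall z (dist z w0) ∩ (fun w => ‖u w‖) ⁻¹' Set.Iic Λ :=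
      ⟨by rw [Metric.mem_closedBall]; linarith, hcon⟩
    have := hpmin this
    simp only [Set.mem_setOf_eq] at this
    linarith
  have hballsub : Metric.ball z d ⊆ Metric.ball w0 (2 * s) :=
    (Metric.ball_subset_closedBall.trans (Metric.closedBall_subset_closedBall hdle)).trans hsub
  have hΛc : (Λ : ℂ) ≠ 0 := by exact_mod_cast hΛ.ne'
  obtain ⟨φ, hφ1, hφ2⟩ := s9_exists_log_ball (g := fun w => u w / Λ) hdpos
    ((hu.mono hballsub).div_const _) (by
      intro w hw h
      have := hbig w hw
      rw [div_eq_zero_iff] at h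
      rcases h with h | h
      · rw [h] at this; simp at this; linarith
      · exact hΛc h)
  have hre : ∀ w ∈ Metric.ball z d, ‖u w‖ = Λ * Real.exp (φ w).re := by
    intro w hw
    have := congrArg norm (hφ2 w hw)
    rw [Complex.norm_exp, norm_div, Complex.norm_real, Real.norm_of_nonneg hΛ.le] at this
    rw [this]; field_simp
  have hrepos : ∀ w ∈ Metric.ball z d, 0 < (φ w).re := by
    intro w hw
    have h1 := hre w hw
    have h2 := hbig w hw
    rw [h1] at h2
    by_contra hcon
    push Not at hcon
    have := Real.exp_le_one_iff.2 hcon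
    nlinarith
  have hφd : DifferentiableOn ℂ φ (Metric.ball z d) :=
    fun w hw => (hφ1 w hw).differentiableAt.differentiableWithinAt
  set v := (φ z).re with hv
  have hvpos : 0 < v := hrepos z (Metric.mem_ball_self hdpos)
  have hlow : ∀ t : ℝ, 0 < t → t < 1 → Λ * (1 + v * t / 2) ≤ ‖u (p + t * (z - p))‖ := by
    intro t ht0 ht1
    have hn : ‖p + t * (z - p) - z‖ = (1 - t) * d := by
      have : p + t * (z - p) - z = ((1 - t : ℝ) : ℂ) * (p - z) := by push_cast; ring
      rw [this, norm_mul, Complex.norm_real, Real.norm_of_nonneg (by linarith), hd, dist_eq_norm]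
    have hmem : p + t * (z - p) ∈ Metric.ball z d := by
      rw [Metric.mem_ball, dist_eq_norm, hn]; nlinarith
    have hh := s9_harnack_lower hφd hrepos hmem
    rw [hn] at hh
    have hp := hrepos _ hmem
    have hr := hre _ hmem
    set q := (φ (p + t * (z - p))).re
    have h1 : v * t ≤ q * (2 - t) := by
      have : d * (v * t) ≤ d * (q * (2 - t)) := by nlinarith
      exact le_of_mul_le_mul_left this hdpos
    have h2 : v * t / 2 ≤ q := by nlinarith
    rw [hr]
    have := Real.add_one_le_exp q
    apply mul_le_mul_of_nonneg_left _ hΛ.le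
    linarith
  have hpmem : p ∈ Metric.ball w0 (2 * s) := hsub hp1
  have hder : HasDerivAt u (deriv u p) p :=
    (hu.differentiableAt (Metric.isOpen_ball.mem_nhds hpmem)).hasDerivAt
  have hpath : HasDerivAt (fun t : ℝ => u (p + t * (z - p))) (deriv u p * (z - p)) 0 := by
    have h1 : HasDerivAt (fun t : ℝ => p + (t:ℂ) * (z - p)) (z - p) 0 := by
      simpa using ((Complex.ofRealCLM.hasDerivAt (x := 0)).mul_const (z - p)).const_add p
    have h2 : HasDerivAt u (deriv u p) (p + ((0:ℝ):ℂ) * (z - p)) := by simpa using hder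
    exact h2.comp (0:ℝ) h1
  have hctn : Tendsto (fun t : ℝ => ‖u (p + t * (z - p))‖) (𝓝[>] 0) (𝓝 ‖u p‖) := by
    have := (hpath.continuousAt.norm).tendsto.mono_left (nhdsWithin_le_nhds (s := Set.Ioi 0))
    simpa using this
  have hIoo : ∀ᶠ t : ℝ in 𝓝[>] 0, 0 < t ∧ t < 1 := by
    filter_upwards [Ioo_mem_nhdsGT (show (0:ℝ) < 1 by norm_num)] with t ht using ht
  have hpeq : ‖u p‖ = Λ := by
    apply le_antisymm hp2'
    refine ge_of_tendsto hctn ?_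
    filter_upwards [hIoo] with t ht
    have := hlow t ht.1 ht.2
    have : 0 ≤ Λ * (v * t / 2) := by have := ht.1; positivity
    nlinarith
  have hslope : Tendsto (fun t : ℝ => ‖slope (fun t : ℝ => u (p + t * (z - p))) 0 t‖) (𝓝[>] 0)
      (𝓝 ‖deriv u p * (z - p)‖) :=
    ((hasDerivAt_iff_tendsto_slope.1 hpath).norm).mono_left
      (nhdsWithin_mono _ (fun t (ht : 0 < t) => ht.ne'))
  have hge : Λ * v / 2 ≤ ‖deriv u p * (z - p)‖ := by
    refine ge_of_tendsto hslope ?_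
    filter_upwards [hIoo] with t ht
    have h1 := hlow t ht.1 ht.2
    have h2 := norm_sub_norm_le (u (p + t * (z - p))) (u p)
    rw [slope_def_module, norm_smul]
    simp only [sub_zero, Complex.ofReal_zero, zero_mul, add_zero, norm_inv,
      Real.norm_of_nonneg ht.1.le]
    rw [inv_mul_eq_div, le_div_iff₀ ht.1]
    nlinarith
  have hDp := hD p hpmem hpeq
  rw [norm_mul, norm_sub_rev, ← dist_eq_norm, ← hd] at hge
  have hv2 : v ≤ 2 * D * dist z w0 / Λ := by
    rw [le_div_iff₀ hΛ]
    have : ‖deriv u p‖ * d ≤ D * dist z w0 := by gcongr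
    nlinarith
  rw [hre z (Metric.mem_ball_self hdpos)]
  gcongr



/-! ### Part 3: fixed points of exponentials, Montel, Hurwitz, entire functions with linear growth -/

theorem s9_lemmaW (κ : ℂ) : ∃ w : ℂ, w.im ≠ 0 ∧ w = Complex.exp (w + κ) := by
  obtain ⟨n, hn⟩ := exists_nat_gt (2 * (20 + ‖κ‖))
  have hn0 : (0:ℝ) < n := by linarith [norm_nonneg κ]
  have hπ3 := Real.pi_gt_three
  have hπ4 := Real.pi_lt_d2
  set c : ℂ := 2 * Real.pi * Complex.I * n with hc
  have hcim : c.im = 2 * Real.pi * n := by simp [hc]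
  have hcn : ‖c‖ = 2 * Real.pi * n := by
    rw [hc]; simp [abs_of_pos Real.pi_pos]
  set T : ℂ → ℂ := fun w => Complex.log w + c - κ with hT
  have him : ∀ w ∈ Metric.closedBall c n, 5 * (n:ℝ) ≤ w.im := by
    intro w hw
    have h1 : ‖w - c‖ ≤ n := by simpa [dist_eq_norm] using hw
    have h2 := (Complex.abs_im_le_norm (w - c)).trans h1
    rw [Complex.sub_im, hcim] at h2
    nlinarith [(abs_le.1 h2).1]
  have hnorm : ∀ w ∈ Metric.closedBall c n, 5 * (n:ℝ) ≤ ‖w‖ := fun w hw =>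
    (him w hw).trans ((le_abs_self _).trans (Complex.abs_im_le_norm w))
  have hnorm2 : ∀ w ∈ Metric.closedBall c n, ‖w‖ ≤ 8 * (n:ℝ) := by
    intro w hw
    have h1 : ‖w - c‖ ≤ n := by simpa [dist_eq_norm] using hw
    have := norm_le_norm_sub_add w c
    rw [hcn] at this
    nlinarith
  have hslit : ∀ w ∈ Metric.closedBall c n, w ∈ Complex.slitPlane := by
    intro w hw
    right
    have := him w hw
    intro h; rw [h] at this; linarith
  have hmaps : Set.MapsTo T (Metric.closedBall c n) (Metric.closedBall c n) := by
    intro w hw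
    rw [Metric.mem_closedBall, dist_eq_norm]
    have e : T w - c = Complex.log w - κ := by simp only [hT]; ring
    rw [e]
    have h1 : ‖Complex.log w‖ ≤ |Real.log ‖w‖| + Real.pi := by
      have := Complex.norm_le_abs_re_add_abs_im (Complex.log w)
      rw [Complex.log_re, Complex.log_im] at this
      linarith [Complex.abs_arg_le_pi w]
    have h2 : 1 ≤ ‖w‖ := by have := hnorm w hw; linarith [norm_nonneg κ]
    rw [abs_of_nonneg (Real.log_nonneg h2)] at h1
    have h3 : Real.log ‖w‖ ≤ 15 + n / 2 - 1 := by
      have h4 : Real.log ‖w‖ ≤ Real.log (16 * (n / 2)) :=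
        Real.log_le_log (by linarith) (by linarith [hnorm2 w hw])
      rw [Real.log_mul (by norm_num) (by positivity)] at h4
      have h5 := Real.log_le_sub_one_of_pos (show (0:ℝ) < 16 by norm_num)
      have h6 := Real.log_le_sub_one_of_pos (show (0:ℝ) < n / 2 by positivity)
      linarith
    have := norm_sub_le (Complex.log w) κ
    linarith
  have hlip : LipschitzOnWith (1/2) T (Metric.closedBall c n) := by
    apply Convex.lipschitzOnWith_of_nnnorm_hasDerivWithin_le (f' := fun w => w⁻¹)
      (convex_closedBall c n)
    · intro w hw
      exact (((Complex.hasDerivAt_log (hslit w hw)).add_const c).sub_const κ).hasDerivWithinAt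
    · intro w hw
      rw [← NNReal.coe_le_coe, coe_nnnorm, norm_inv]
      have := hnorm w hw
      have h2 : 2 ≤ ‖w‖ := by linarith [norm_nonneg κ]
      simpa using inv_anti₀ (by norm_num) h2
  have hcon : ContractingWith (1/2) (hmaps.restrict T _ _) := by
    refine ⟨by rw [← NNReal.coe_lt_coe]; norm_num, ?_⟩
    exact hlip.mapsToRestrict hmaps
  obtain ⟨w, hw, hfix, -⟩ := ContractingWith.exists_fixedPoint'
    (Metric.isClosed_closedBall.isComplete) hmaps hcon
    (Metric.mem_closedBall_self hn0.le) (edist_ne_top _ _)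
  refine ⟨w, ?_, ?_⟩
  · have := him w hw
    intro h; rw [h] at this; linarith
  · have hfix' : Complex.log w + c - κ = w := hfix
    have hw0 : w ≠ 0 := by
      have := hnorm w hw
      intro h; rw [h] at this; simp at this; linarith
    have e : w + κ = Complex.log w + n * (2 * Real.pi * Complex.I) := by
      rw [hc] at hfix'; linear_combination -hfix'
    rw [e, Complex.exp_add, Complex.exp_log hw0, Complex.exp_nat_mul_two_pi_mul_I, mul_one]

theorem s9_entire_affine {h : ℂ → ℂ} (hh : Differentiable ℂ h) {A B : ℝ} (hB : 0 ≤ B)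
    (hle : ∀ z, (h z).re ≤ A + B * ‖z‖) : ∃ a b : ℂ, ∀ z, h z = a * z + b := by
  have hbd : ∀ c, ‖deriv h c‖ ≤ 2 * B := by
    intro c
    have key : ∀ ρ : ℝ, 0 < ρ → ‖deriv h c‖ ≤ 2 * (A + B * ‖c‖ + 1 - (h c).re) / ρ + 2 * B := by
      intro ρ hρ
      have := s9_deriv_center (φ := fun z => ((A + B * (‖c‖ + ρ) + 1 : ℝ) : ℂ) - h z) (c := c) hρ
        (hh.const_sub _).differentiableOn (by
          intro z hz
          have h1 : ‖z - c‖ < ρ := by simpa [dist_eq_norm] using hz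
          have h2 := norm_le_norm_sub_add z c
          have := hle z
          rw [Complex.sub_re, Complex.ofReal_re]
          nlinarith)
      rw [deriv_const_sub, norm_neg, Complex.sub_re, Complex.ofReal_re] at this
      calc _ ≤ _ := this
        _ = _ := by field_simp; ring
    have ht : Tendsto (fun ρ : ℝ => 2 * (A + B * ‖c‖ + 1 - (h c).re) / ρ + 2 * B) atTop
        (𝓝 (0 + 2 * B)) := (tendsto_const_nhds.div_atTop tendsto_id).add_const _
    rw [zero_add] at ht
    refine ge_of_tendsto ht ?_
    filter_upwards [eventually_gt_atTop 0] with ρ hρ using key ρ hρ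
  have hd : Differentiable ℂ (deriv h) := fun z =>
    (hh.differentiableOn.deriv isOpen_univ).differentiableAt Filter.univ_mem
  have hconst : ∀ z, deriv h z = deriv h 0 := fun z =>
    hd.apply_eq_apply_of_bounded (isBounded_iff_forall_norm_le.2 ⟨2 * B, by
      rintro _ ⟨y, rfl⟩; exact hbd y⟩) z 0
  refine ⟨deriv h 0, h 0, fun z => ?_⟩
  have hdd : ∀ w, HasDerivAt (fun w => h w - deriv h 0 * w) 0 w := by
    intro w
    have h1 := (hh w).hasDerivAt.sub ((hasDerivAt_id w).const_mul (deriv h 0))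
    rw [hconst w, mul_one, sub_self] at h1
    exact h1
  have := is_const_of_deriv_eq_zero (fun w => (hdd w).differentiableAt)
    (fun w => (hdd w).deriv) z 0
  simp at this
  linear_combination this

theorem s9_montel {g : ℕ → ℂ → ℂ} {R : ℕ → ℝ} (hR : Tendsto R atTop atTop)
    (hd : ∀ n, DifferentiableOn ℂ (g n) (Metric.ball 0 (R n))) {B : ℝ → ℝ} (hBm : Monotone B)
    (hb : ∀ n, ∀ z ∈ Metric.ball 0 (R n), ‖g n z‖ ≤ B ‖z‖) (l : Ultrafilter ℕ)
    (hl : (l : Filter ℕ) ≤ atTop) :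
    ∃ U : ℂ → ℂ, Differentiable ℂ U ∧ TendstoLocallyUniformly g U l ∧
      TendstoLocallyUniformly (fun n => deriv (g n)) (deriv U) l := by
  have hRl : ∀ k : ℝ, ∀ᶠ n in (l : Filter ℕ), k < R n := fun k =>
    hl (hR.eventually (eventually_gt_atTop k))
  have hpt : ∀ z, ∃ x, Tendsto (fun n => g n z) l (𝓝 x) := by
    intro z
    have h1 : ∀ᶠ n in (l : Filter ℕ), g n z ∈ Metric.closedBall 0 (B ‖z‖) := by
      filter_upwards [hRl ‖z‖] with n hn
      have := hb n z (by simpa using hn)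
      simpa using this
    obtain ⟨x, -, hx⟩ := (isCompact_closedBall (0:ℂ) (B ‖z‖)).ultrafilter_le_nhds
      (l.map (fun n => g n z)) (by
        rw [le_principal_iff]; exact h1)
    exact ⟨x, hx⟩
  choose U hU using hpt
  have hlip : ∀ k : ℝ, 0 < k → ∀ n, k + 1 < R n → ∀ z ∈ Metric.ball (0:ℂ) k,
      ∀ w ∈ Metric.ball (0:ℂ) k, ‖g n z - g n w‖ ≤ B (k + 1) * ‖z - w‖ := by
    intro k hk n hn z hz w hw
    refine (convex_ball (0:ℂ) k).norm_image_sub_le_of_norm_deriv_le (𝕜 := ℂ) ?_ ?_ hw hz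
    · intro y hy
      exact (hd n).differentiableAt (Metric.isOpen_ball.mem_nhds
        (Metric.ball_subset_ball (by linarith) hy))
    · intro y hy
      have hyk : ‖y‖ < k := by simpa using hy
      have hsub : Metric.closedBall y 1 ⊆ Metric.ball 0 (R n) := by
        intro p hp
        have h1 : ‖p - y‖ ≤ 1 := by simpa [dist_eq_norm] using hp
        have h2 := norm_le_norm_sub_add p y
        simp only [Metric.mem_ball, dist_zero_right]; linarith
      rw [← Complex.cderiv_eq_deriv Metric.isOpen_ball (hd n) one_pos hsub]
      have := Complex.norm_cderiv_le (z := y) (f := g n) (M := B (k + 1)) one_pos (by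
        intro p hp
        have hp' := Metric.sphere_subset_closedBall hp
        refine (hb n p (hsub hp')).trans (hBm ?_)
        have h1 : ‖p - y‖ ≤ 1 := by simpa [dist_eq_norm] using hp'
        have h2 := norm_le_norm_sub_add p y
        linarith)
      simpa using this
  have hlipU : ∀ k : ℝ, 0 < k → ∀ z ∈ Metric.ball (0:ℂ) k,
      ∀ w ∈ Metric.ball (0:ℂ) k, ‖U z - U w‖ ≤ B (k + 1) * ‖z - w‖ := by
    intro k hk z hz w hw
    refine le_of_tendsto ((hU z).sub (hU w)).norm ?_
    filter_upwards [hRl (k + 1)] with n hn using hlip k hk n hn z hz w hw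
  have hloc : TendstoLocallyUniformly g U l := by
    rw [Metric.tendstoLocallyUniformly_iff]
    intro ε hε z
    set k := ‖z‖ + 1 with hk
    have hk0 : 0 < k := by positivity
    set L := max (B (k + 1)) 1 with hL
    have hL0 : 0 < L := lt_of_lt_of_le one_pos (le_max_right _ _)
    refine ⟨Metric.ball z (min 1 (ε / (4 * L))), Metric.ball_mem_nhds _ (by positivity), ?_⟩
    filter_upwards [hRl (k + 1), (Metric.tendsto_nhds.1 (hU z)) (ε / 4) (by positivity)]
      with n hn hnz w hw
    have hw1 : ‖w - z‖ < 1 := by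
      have := (Metric.mem_ball.1 hw).trans_le (min_le_left _ _)
      rwa [dist_eq_norm] at this
    have hw2 : L * ‖w - z‖ < ε / 4 := by
      have := (Metric.mem_ball.1 hw).trans_le (min_le_right _ _)
      rw [dist_eq_norm, lt_div_iff₀ (by positivity)] at this
      linarith
    have hzk : z ∈ Metric.ball (0:ℂ) k := by simp [hk]
    have hwk : w ∈ Metric.ball (0:ℂ) k := by
      have := norm_le_norm_sub_add w z
      simp only [Metric.mem_ball, dist_zero_right]; linarith
    have h1 := hlip k hk0 n hn w hwk z hzk
    have h2 := hlipU k hk0 w hwk z hzk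
    have h3 : B (k + 1) * ‖w - z‖ ≤ L * ‖w - z‖ := by gcongr; exact le_max_left _ _
    rw [dist_eq_norm] at hnz ⊢
    have e : U w - g n w = (U w - U z) - (g n z - U z) - (g n w - g n z) := by ring
    rw [e]
    have h4 := norm_sub_le ((U w - U z) - (g n z - U z)) (g n w - g n z)
    have h5 := norm_sub_le (U w - U z) (g n z - U z)
    linarith
  have hev : ∀ k : ℝ, ∀ᶠ n in (l : Filter ℕ), DifferentiableOn ℂ (g n) (Metric.ball 0 k) := by
    intro k
    filter_upwards [hRl k] with n hn
    exact (hd n).mono (Metric.ball_subset_ball hn.le)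
  refine ⟨U, fun z => ?_, hloc, ?_⟩
  · exact ((hloc.tendstoLocallyUniformlyOn (s := Metric.ball 0 (‖z‖ + 1))).differentiableOn
      (hev _) Metric.isOpen_ball).differentiableAt (Metric.isOpen_ball.mem_nhds (by simp))
  · intro u hu z
    have := (hloc.tendstoLocallyUniformlyOn (s := Metric.ball 0 (‖z‖ + 1))).deriv
      (hev _) Metric.isOpen_ball
    obtain ⟨t, ht, hh⟩ := this u hu z (by simp)
    refine ⟨t, ?_, hh⟩
    rwa [(Metric.isOpen_ball.nhdsWithin_eq (by simp))] at ht

theorem s9_hurwitz {H : ℕ → ℂ → ℂ} {U : ℂ → ℂ} {l : Filter ℕ} (hU : Differentiable ℂ U)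
    (hloc : TendstoLocallyUniformly H U l) {z0 : ℂ} {r0 : ℝ} (hr0 : 0 < r0)
    (hd : ∀ᶠ n in l, DifferentiableOn ℂ (H n) (Metric.ball z0 r0)) (hz : U z0 = 0)
    (hne : ∃ w, U w ≠ 0) : ∀ ε > 0, ∀ᶠ n in l, ∃ w ∈ Metric.closedBall z0 ε, H n w = 0 := by
  intro ε hε
  have hiso : ∀ᶠ z in 𝓝[≠] z0, U z ≠ 0 := by
    rcases (hU.analyticAt z0).eventually_eq_zero_or_eventually_ne_zero with h | h
    · exfalso
      obtain ⟨w, hw⟩ := hne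
      apply hw
      have := AnalyticOnNhd.eqOn_zero_of_preconnected_of_eventuallyEq_zero (U := Set.univ)
        (fun z _ => hU.analyticAt z) isPreconnected_univ (Set.mem_univ z0) h
      exact this (Set.mem_univ w)
    · exact h
  rw [eventually_nhdsWithin_iff, Metric.eventually_nhds_iff] at hiso
  obtain ⟨r1, hr1, hiso⟩ := hiso
  set r := min (min (r0 / 2) (r1 / 2)) ε with hr
  have hrpos : 0 < r := by positivity
  have hrr0 : r < r0 := by
    have : r ≤ r0 / 2 := (min_le_left _ _).trans (min_le_left _ _)
    linarith
  have hrr1 : r < r1 := by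
    have : r ≤ r1 / 2 := (min_le_left _ _).trans (min_le_right _ _)
    linarith
  obtain ⟨p, hp, hpmin⟩ := (isCompact_sphere z0 r).exists_isMinOn
    (NormedSpace.sphere_nonempty.2 hrpos.le) (f := fun z => ‖U z‖)
    (hU.continuous.norm.continuousOn)
  have hps : dist p z0 = r := hp
  set δ := ‖U p‖ with hδ
  have hδpos : 0 < δ := norm_pos_iff.2 (hiso (by rw [hps]; exact hrr1) (by
    intro h; rw [h] at hps; simp at hps; linarith))
  have hunif : TendstoUniformlyOn H U l (Metric.closedBall z0 r) :=
    (tendstoLocallyUniformlyOn_iff_tendstoUniformlyOn_of_compact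
      (isCompact_closedBall z0 r)).1 hloc.tendstoLocallyUniformlyOn
  rw [Metric.tendstoUniformlyOn_iff] at hunif
  filter_upwards [hd, hunif (δ / 8) (by positivity)] with n hn hclose
  have hz0 : ‖H n z0‖ < δ / 8 := by
    have := hclose z0 (Metric.mem_closedBall_self hrpos.le)
    rw [hz, dist_zero_left] at this
    exact this
  have hsph : ∀ z ∈ Metric.sphere z0 r, δ / 2 ≤ ‖H n z - H n z0‖ := by
    intro z hzs
    have h1 : δ ≤ ‖U z‖ := hpmin hzs
    have h2 := hclose z (Metric.sphere_subset_closedBall hzs)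
    rw [dist_eq_norm] at h2
    have h3 := norm_sub_norm_le (H n z) (H n z0)
    have h4 := norm_sub_norm_le (U z) (H n z)
    linarith
  have hcl : Metric.closedBall z0 r ⊆ Metric.ball z0 r0 := Metric.closedBall_subset_ball hrr0
  have hdc : DiffContOnCl ℂ (H n) (Metric.ball z0 r) :=
    (hn.mono hcl).diffContOnCl_ball subset_rfl
  have hfreq : ∃ᶠ z in 𝓝 z0, H n z ≠ H n z0 := by
    intro hcon
    have hcon' : ∀ᶠ z in 𝓝 z0, H n z = H n z0 := by
      filter_upwards [hcon] with z hz using not_not.1 hz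
    have := AnalyticOnNhd.eqOn_of_preconnected_of_eventuallyEq (f := H n) (g := fun _ => H n z0)
      (hn.analyticOnNhd Metric.isOpen_ball) (fun _ _ => analyticAt_const)
      (convex_ball z0 r0).isPreconnected (Metric.mem_ball_self hr0) hcon'
    have h1 := this (hcl (Metric.sphere_subset_closedBall hp))
    have h2 := hsph p hp
    simp only at h1
    rw [h1] at h2
    simp at h2
    linarith
  have := hdc.ball_subset_image_closedBall hrpos hsph hfreq
  obtain ⟨w, hw, hw0⟩ := this (show (0:ℂ) ∈ Metric.ball (H n z0) (δ / 2 / 2) by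
    rw [Metric.mem_ball, dist_zero_left]; linarith)
  exact ⟨w, Metric.closedBall_subset_closedBall (min_le_right _ _) hw, hw0⟩


/-! ### Part 4: a normality theorem -/

/-- The class of functions `u` with `u' ≠ 1` and `u' ∈ [-1, 0]` at zeros of `u`. -/
def s9PP (u : ℂ → ℂ) (V : Set ℂ) : Prop :=
  DifferentiableOn ℂ u V ∧ ∀ z ∈ V, deriv u z ≠ 1 ∧
    (u z = 0 → (deriv u z).im = 0 ∧ -1 ≤ (deriv u z).re ∧ (deriv u z).re ≤ 0)

theorem s9_norm_le_one_of_seg {v : ℂ} (h : v.im = 0 ∧ -1 ≤ v.re ∧ v.re ≤ 0) : ‖v‖ ≤ 1 := by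
  have := Complex.norm_le_abs_re_add_abs_im v
  rw [h.1, abs_zero, add_zero, abs_of_nonpos h.2.2] at this
  linarith

theorem s9_no_limit {U : ℂ → ℂ} (hU : s9PP U Set.univ) {A B : ℝ} (hA : 0 ≤ A) (hB : 0 ≤ B)
    (hgr : ∀ z, ‖U z‖ ≤ A * Real.exp (B * ‖z‖)) (h0 : 2 ≤ ‖deriv U 0‖) : False := by
  have hUd : Differentiable ℂ U := fun z => hU.1.differentiableAt Filter.univ_mem
  have hUdd : Differentiable ℂ (deriv U) := fun z =>
    (hUd.differentiableOn.deriv isOpen_univ).differentiableAt Filter.univ_mem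
  obtain ⟨h, hh, hexp⟩ := s9_exists_log_entire (g := fun z => 1 - deriv U z)
    (hUdd.const_sub 1) (fun z hz => (hU.2 z trivial).1 (by linear_combination -hz))
  have hder : ∀ z, ‖deriv U z‖ ≤ A * Real.exp (B * (‖z‖ + 1)) := by
    intro z
    rw [← Complex.cderiv_eq_deriv isOpen_univ hUd.differentiableOn one_pos (Set.subset_univ _)]
    have := Complex.norm_cderiv_le (z := z) (f := U) (M := A * Real.exp (B * (‖z‖ + 1))) one_pos (by
      intro p hp
      refine (hgr p).trans ?_
      have h1 : ‖p - z‖ = 1 := by simpa [dist_eq_norm] using hp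
      have h2 := norm_le_norm_sub_add p z
      gcongr
      linarith)
    simpa using this
  obtain ⟨a, b, hab⟩ := s9_entire_affine hh (A := Real.log (1 + A * Real.exp B)) hB (by
    intro z
    have h1 : Real.exp (h z).re = ‖1 - deriv U z‖ := by
      rw [← Complex.norm_exp, hexp]
    have h2 : ‖1 - deriv U z‖ ≤ 1 + ‖deriv U z‖ := by
      simpa using norm_sub_le (1:ℂ) (deriv U z)
    have h3 : Real.exp (h z).re ≤ (1 + A * Real.exp B) * Real.exp (B * ‖z‖) := by
      rw [h1]
      have h4 := hder z
      rw [mul_add, mul_one, Real.exp_add] at h4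
      have h5 : 1 ≤ Real.exp (B * ‖z‖) := Real.one_le_exp (by positivity)
      nlinarith
    have hpos : 0 < 1 + A * Real.exp B := by positivity
    rw [← Real.exp_log hpos, ← Real.exp_add] at h3
    exact Real.exp_le_exp.1 h3)
  have hU' : ∀ z, deriv U z = 1 - Complex.exp (a * z + b) := by
    intro z
    rw [← hab, hexp]; ring
  by_cases ha : a = 0
  · subst ha
    set k := 1 - Complex.exp b with hk
    have hk' : ∀ z, deriv U z = k := by intro z; rw [hU' z]; simp [hk]
    have hk2 : 2 ≤ ‖k‖ := by rw [← hk' 0]; exact h0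
    have hk0 : k ≠ 0 := by intro h; rw [h] at hk2; simp at hk2; linarith
    have hdd : ∀ w, HasDerivAt (fun w => U w - k * w) 0 w := by
      intro w
      have h1 := (hUd w).hasDerivAt.sub ((hasDerivAt_id w).const_mul k)
      rw [hk' w, mul_one, sub_self] at h1
      exact h1
    have := is_const_of_deriv_eq_zero (fun w => (hdd w).differentiableAt)
      (fun w => (hdd w).deriv) (-U 0 / k) 0
    have hz : U (-U 0 / k) = 0 := by
      have e : k * (-U 0 / k) = -U 0 := by field_simp
      simp only [e, mul_zero, sub_zero] at this
      linear_combination this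
    have h1 := s9_norm_le_one_of_seg ((hU.2 (-U 0 / k) trivial).2 hz)
    rw [hk'] at h1
    linarith
  · set d := U 0 + Complex.exp b / a with hd
    have hdd : ∀ w, HasDerivAt (fun w => U w - (w - Complex.exp (a * w + b) / a)) 0 w := by
      intro w
      have h2 : HasDerivAt (fun w => a * w + b) a w := by
        simpa using ((hasDerivAt_id w).const_mul a).add_const b
      have h1 := (hUd w).hasDerivAt.sub ((hasDerivAt_id w).sub ((h2.cexp).div_const a))
      rw [hU' w] at h1
      have e : 1 - Complex.exp (a * w + b) - (1 - Complex.exp (a * w + b) * a / a) = 0 := by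
        field_simp; ring
      rw [e] at h1
      exact h1
    have hform : ∀ z, U z = z - Complex.exp (a * z + b) / a + d := by
      intro z
      have := is_const_of_deriv_eq_zero (fun w => (hdd w).differentiableAt)
        (fun w => (hdd w).deriv) z 0
      simp only [mul_zero, zero_add, zero_sub] at this
      rw [hd]; linear_combination this
    obtain ⟨w, hwim, hw⟩ := s9_lemmaW (b - a * d)
    have e : a * (w / a - d) + b = w + (b - a * d) := by field_simp; ring
    have hz : U (w / a - d) = 0 := by
      rw [hform, e, ← hw]; ring
    have h1 := ((hU.2 (w / a - d) trivial).2 hz).1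
    rw [hU', e, ← hw] at h1
    simp at h1
    exact hwim h1

theorem s9_renorm {u : ℂ → ℂ} {c : ℂ} {ρ N : ℝ} (hρ : 0 < ρ) (hN : 0 < N)
    (hu : s9PP u (Metric.ball c ρ)) (hbad : 2 + N * ‖u c‖ ^ 2 / ρ ^ 2 < ‖deriv u c‖) :
    ∃ (g : ℂ → ℂ) (R : ℝ), 0 < R ∧ N / 8 ≤ R ^ 2 ∧ s9PP g (Metric.ball 0 R) ∧
      ‖deriv g 0‖ = 2 + 2 * ‖g 0‖ ^ 2 ∧
      ∀ ζ ∈ Metric.ball (0:ℂ) (R / 2), ‖deriv g ζ‖ ≤ 2 + 8 * ‖g ζ‖ ^ 2 := by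
  have hcb : c ∈ Metric.ball c ρ := Metric.mem_ball_self hρ
  have huc : u c ≠ 0 := by
    intro h
    have := s9_norm_le_one_of_seg ((hu.2 c hcb).2 h)
    rw [h] at hbad
    simp at hbad
    linarith
  set Q : ℂ → ℝ := fun z => (ρ / 2 - ‖z - c‖) ^ 2 * max (‖deriv u z‖ - 2) 0 / (2 * ‖u z‖ ^ 2) with hQ
  have hsub : Metric.closedBall c (ρ / 2) ⊆ Metric.ball c ρ :=
    Metric.closedBall_subset_ball (by linarith)
  have hQc : ContinuousOn Q (Metric.closedBall c (ρ / 2)) := by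
    intro z hz
    apply ContinuousAt.continuousWithinAt
    have hzb := Metric.isOpen_ball.mem_nhds (hsub hz)
    have h1 : ContinuousAt u z := hu.1.continuousOn.continuousAt hzb
    have h2 : ContinuousAt (deriv u) z :=
      ((hu.1.deriv Metric.isOpen_ball).continuousOn).continuousAt hzb
    by_cases h0 : u z = 0
    · have h3 := s9_norm_le_one_of_seg ((hu.2 z (hsub hz)).2 h0)
      have h4 : ∀ᶠ w in 𝓝 z, ‖deriv u w‖ < 2 :=
        h2.norm.eventually_lt continuousAt_const (by linarith)
      have h5 : Q =ᶠ[𝓝 z] fun _ => 0 := by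
        filter_upwards [h4] with w hw
        have : max (‖deriv u w‖ - 2) 0 = 0 := max_eq_right (by linarith)
        simp [hQ, this]
      exact (continuousAt_const).congr h5.symm
    · have h3 : 2 * ‖u z‖ ^ 2 ≠ 0 := by positivity
      rw [hQ]
      have h4 : ContinuousAt (fun z : ℂ => (ρ / 2 - ‖z - c‖) ^ 2) z := by fun_prop
      exact (h4.mul ((h2.norm.sub continuousAt_const).max continuousAt_const)).div
        ((h1.norm.pow 2).const_mul 2) h3
  obtain ⟨p, hp, hpmax⟩ := (isCompact_closedBall c (ρ / 2)).exists_isMaxOn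
    ⟨c, Metric.mem_closedBall_self (by linarith)⟩ hQc
  have hQcval : N / 8 < Q c := by
    have hupos : 0 < ‖u c‖ ^ 2 := by positivity
    have h1 : N * ‖u c‖ ^ 2 / ρ ^ 2 < ‖deriv u c‖ - 2 := by linarith
    have h2 : 0 < ‖deriv u c‖ - 2 := lt_of_le_of_lt (by positivity) h1
    simp only [hQ, sub_self, norm_zero, sub_zero, max_eq_left h2.le]
    rw [lt_div_iff₀ (by positivity)]
    rw [div_lt_iff₀ (by positivity)] at h1
    nlinarith
  have hQp : N / 8 < Q p := lt_of_lt_of_le hQcval (hpmax (Metric.mem_closedBall_self (by linarith)))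
  have hQppos : 0 < Q p := by linarith
  have hpn : ‖p - c‖ ≤ ρ / 2 := by simpa [dist_eq_norm] using hp
  set t := ρ / 2 - ‖p - c‖ with ht
  have htpos : 0 < t := by
    rcases eq_or_lt_of_le (show 0 ≤ t by linarith) with h | h
    · exfalso
      have : Q p = 0 := by simp only [hQ, ← ht, ← h]; simp
      linarith
    · exact h
  have hdpos : 0 < ‖deriv u p‖ - 2 := by
    by_contra hcon
    push Not at hcon
    have : Q p = 0 := by simp only [hQ, max_eq_right hcon]; simp
    linarith
  have hup : u p ≠ 0 := by
    intro h
    have : Q p = 0 := by simp only [hQ, h]; simp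
    linarith
  have hupn : 0 < ‖u p‖ := norm_pos_iff.2 hup
  set σ := ‖u p‖ * Real.sqrt (2 / (‖deriv u p‖ - 2)) with hσ
  have hσpos : 0 < σ := by positivity
  have hσ2 : σ ^ 2 * (‖deriv u p‖ - 2) = 2 * ‖u p‖ ^ 2 := by
    rw [hσ, mul_pow, Real.sq_sqrt (by positivity)]; field_simp
  have hQpval : Q p = (t / σ) ^ 2 := by
    simp only [hQ, max_eq_left hdpos.le, ← ht]
    rw [div_pow, div_eq_div_iff (by positivity) (by positivity), ← hσ2]; ring
  have hσc : (σ : ℂ) ≠ 0 := by exact_mod_cast hσpos.ne'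
  have hmap : ∀ ζ ∈ Metric.ball (0:ℂ) (t / σ), p + σ * ζ ∈ Metric.closedBall c (ρ / 2) := by
    intro ζ hζ
    have h1 : ‖ζ‖ < t / σ := by simpa using hζ
    rw [lt_div_iff₀ hσpos] at h1
    rw [Metric.mem_closedBall, dist_eq_norm]
    have e : p + σ * ζ - c = (p - c) + σ * ζ := by ring
    have h2 := norm_add_le (p - c) (σ * ζ)
    rw [norm_mul, Complex.norm_real, Real.norm_of_nonneg hσpos.le] at h2
    rw [e]; linarith
  have hgder : ∀ ζ ∈ Metric.ball (0:ℂ) (t / σ),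
      HasDerivAt (fun ζ => u (p + σ * ζ) / σ) (deriv u (p + σ * ζ)) ζ := by
    intro ζ hζ
    have h1 : HasDerivAt (fun ζ : ℂ => p + σ * ζ) (σ : ℂ) ζ := by
      simpa using ((hasDerivAt_id ζ).const_mul (σ : ℂ)).const_add p
    have h2 : HasDerivAt u (deriv u (p + σ * ζ)) (p + σ * ζ) :=
      (hu.1.differentiableAt (Metric.isOpen_ball.mem_nhds (hsub (hmap ζ hζ)))).hasDerivAt
    have h3 := (h2.comp ζ h1).div_const (σ : ℂ)
    rw [mul_div_cancel_right₀ _ hσc] at h3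
    exact h3
  have h0mem : (0:ℂ) ∈ Metric.ball (0:ℂ) (t / σ) := Metric.mem_ball_self (by positivity)
  refine ⟨fun ζ => u (p + σ * ζ) / σ, t / σ, by positivity, by rw [← hQpval]; exact hQp.le,
    ⟨?_, ?_⟩, ?_, ?_⟩
  · intro ζ hζ
    exact (hgder ζ hζ).differentiableAt.differentiableWithinAt
  · intro ζ hζ
    rw [(hgder ζ hζ).deriv]
    have h1 := hu.2 _ (hsub (hmap ζ hζ))
    refine ⟨h1.1, fun h => h1.2 ?_⟩
    rw [div_eq_zero_iff] at h
    exact h.resolve_right hσc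
  · rw [(hgder 0 h0mem).deriv]
    simp only [mul_zero, add_zero, norm_div, Complex.norm_real, Real.norm_of_nonneg hσpos.le]
    rw [div_pow]
    have : ‖deriv u p‖ - 2 = 2 * ‖u p‖ ^ 2 / σ ^ 2 := by
      rw [eq_div_iff (by positivity), ← hσ2]; ring
    rw [← mul_div_assoc]; linarith
  · intro ζ hζ
    have hζ' : ζ ∈ Metric.ball (0:ℂ) (t / σ) :=
      Metric.ball_subset_ball (by linarith [show 0 < t / σ by positivity]) hζ
    rw [(hgder ζ hζ').deriv]
    simp only [norm_div, Complex.norm_real, Real.norm_of_nonneg hσpos.le]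
    set z := p + σ * ζ with hz
    by_cases h0 : u z = 0
    · have := s9_norm_le_one_of_seg ((hu.2 z (hsub (hmap ζ hζ'))).2 h0)
      have h2 : 0 ≤ 8 * (‖u z‖ / σ) ^ 2 := by positivity
      linarith
    · have hzn : 0 < ‖u z‖ := norm_pos_iff.2 h0
      have h1 : ‖ζ‖ < t / σ / 2 := by simpa using hζ
      have h1' : σ * ‖ζ‖ < t / 2 := by
        rw [div_right_comm, lt_div_iff₀ hσpos] at h1; linarith
      have h2 : t / 2 ≤ ρ / 2 - ‖z - c‖ := by
        have e : z - c = (p - c) + σ * ζ := by rw [hz]; ring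
        have h2 := norm_add_le (p - c) (σ * ζ)
        rw [norm_mul, Complex.norm_real, Real.norm_of_nonneg hσpos.le] at h2
        rw [e]; linarith
      have h3 : Q z ≤ (t / σ) ^ 2 := by rw [← hQpval]; exact hpmax (hmap ζ hζ')
      have h4 : (t / 2) ^ 2 * (‖deriv u z‖ - 2) / (2 * ‖u z‖ ^ 2) ≤ Q z := by
        simp only [hQ]
        have h5 : (t / 2) ^ 2 ≤ (ρ / 2 - ‖z - c‖) ^ 2 := by gcongr
        have h6 := le_max_left (‖deriv u z‖ - 2) 0
        have h7 := le_max_right (‖deriv u z‖ - 2) 0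
        gcongr ?_ / _
        calc (t / 2) ^ 2 * (‖deriv u z‖ - 2) ≤ (t / 2) ^ 2 * max (‖deriv u z‖ - 2) 0 := by gcongr
          _ ≤ _ := by gcongr
      have h5 := h4.trans h3
      rw [div_le_iff₀ (by positivity)] at h5
      have h6 : t ^ 2 * (‖deriv u z‖ - 2) ≤ t ^ 2 * (8 * (‖u z‖ / σ) ^ 2) := by
        calc t ^ 2 * (‖deriv u z‖ - 2) = 4 * ((t / 2) ^ 2 * (‖deriv u z‖ - 2)) := by ring
          _ ≤ 4 * ((t / σ) ^ 2 * (2 * ‖u z‖ ^ 2)) := by gcongr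
          _ = _ := by field_simp; ring
      have h7 := le_of_mul_le_mul_left h6 (by positivity)
      linarith

theorem s9_center_bound {g : ℂ → ℂ} {R : ℝ} (hR : 1 ≤ R)
    (hg : DifferentiableOn ℂ g (Metric.ball 0 R)) (h0 : ‖deriv g 0‖ = 2 + 2 * ‖g 0‖ ^ 2)
    (hb : ∀ ζ ∈ Metric.ball (0:ℂ) (R / 2), ‖deriv g ζ‖ ≤ 2 + 8 * ‖g ζ‖ ^ 2) : ‖g 0‖ ≤ 256 := by
  by_contra hcon
  push Not at hcon
  have hbig : ∀ w ∈ Metric.ball (0:ℂ) (1/8), 1 < ‖g w‖ := by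
    intro w hw
    by_contra hle
    push Not at hle
    have hw' : ‖w‖ < 1/8 := by simpa using hw
    have hsub : Metric.ball w (2 * (1/8)) ⊆ Metric.ball (0:ℂ) (R / 2) := by
      intro y hy
      have h1 : ‖y - w‖ < 2 * (1/8) := by simpa [dist_eq_norm] using hy
      have h2 := norm_le_norm_sub_add y w
      simp only [Metric.mem_ball, dist_zero_right]; linarith
    have := s9_hopf (u := g) (w0 := w) (s := 1/8) (Λ := 1) (D := 10) one_pos (by norm_num)
      (hg.mono (hsub.trans (Metric.ball_subset_ball (by linarith)))) hle (by
        intro y hy hy1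
        have := hb y (hsub hy)
        rw [hy1] at this
        linarith) (z := 0) (by simpa using hw)
    rw [dist_zero_left] at this
    have h3 : Real.exp (2 * 10 * ‖w‖ / 1) ≤ Real.exp 1 ^ 3 := by
      rw [← Real.exp_nat_mul]; apply Real.exp_le_exp.2; push_cast; linarith
    have h4 : Real.exp 1 ^ 3 ≤ 3 ^ 3 := by
      have := Real.exp_one_lt_d9
      gcongr; linarith
    linarith
  have hsub8 : Metric.ball (0:ℂ) (1/8) ⊆ Metric.ball (0:ℂ) R := Metric.ball_subset_ball (by linarith)
  obtain ⟨φ, hφ1, hφ2⟩ := s9_exists_log_ball (g := g) (show (0:ℝ) < 1/8 by norm_num)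
    (hg.mono hsub8) (by
      intro w hw h
      have := hbig w hw
      rw [h] at this; simp at this; linarith)
  have hre : ∀ w ∈ Metric.ball (0:ℂ) (1/8), (φ w).re = Real.log ‖g w‖ := by
    intro w hw
    rw [← hφ2 w hw, Complex.norm_exp, Real.log_exp]
  have h0m : (0:ℂ) ∈ Metric.ball (0:ℂ) (1/8) := by simp
  have := s9_deriv_center (φ := φ) (c := 0) (show (0:ℝ) < 1/8 by norm_num)
    (fun w hw => (hφ1 w hw).differentiableAt.differentiableWithinAt) (by
      intro w hw
      rw [hre w hw]; exact Real.log_pos (hbig w hw))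
  rw [(hφ1 0 h0m).deriv, hre 0 h0m, norm_div, h0, div_le_iff₀ (by linarith)] at this
  set G := ‖g 0‖
  have hlog : Real.log G ≤ 8 + (G / 256 - 1) := by
    have e : G = 2 ^ 8 * (G / 256) := by ring
    have h1 : Real.log G = 8 * Real.log 2 + Real.log (G / 256) := by
      conv_lhs => rw [e]
      rw [Real.log_mul (by norm_num) (by positivity), Real.log_pow]
      norm_num
    have h2 := Real.log_le_sub_one_of_pos (show 0 < G / 256 by positivity)
    have h3 := Real.log_two_lt_d9
    linarith
  nlinarith

theorem s9_growth {g : ℂ → ℂ} {R : ℝ} (hg : DifferentiableOn ℂ g (Metric.ball 0 R))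
    (h0 : ‖g 0‖ ≤ 256) (hR : 0 < R)
    (hb : ∀ ζ ∈ Metric.ball (0:ℂ) (R / 2), ‖deriv g ζ‖ ≤ 2 + 8 * ‖g ζ‖ ^ 2)
    {z : ℂ} (hz : z ∈ Metric.ball (0:ℂ) (R / 4)) : ‖g z‖ ≤ 256 * Real.exp (5000 * ‖z‖) := by
  have e : 2 * (R / 4) = R / 2 := by ring
  have := s9_hopf (u := g) (w0 := 0) (s := R / 4) (Λ := 256) (D := 2 + 8 * 256 ^ 2) (by norm_num)
    (by norm_num) (hg.mono (by rw [e]; exact Metric.ball_subset_ball (by linarith))) h0 (by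
      intro w hw h
      rw [e] at hw
      have := hb w hw
      rwa [h] at this) hz
  refine this.trans ?_
  rw [dist_zero_right]
  gcongr
  rw [div_le_iff₀ (by norm_num)]
  nlinarith [norm_nonneg z]

theorem s9_theoremN : ∃ C : ℝ, 0 < C ∧ ∀ (u : ℂ → ℂ) (c : ℂ) (ρ : ℝ), 0 < ρ →
    s9PP u (Metric.ball c ρ) → ‖deriv u c‖ ≤ 2 + C * ‖u c‖ ^ 2 / ρ ^ 2 := by
  by_contra hcon
  push Not at hcon
  have hex : ∀ n : ℕ, ∃ (g : ℂ → ℂ) (R : ℝ), (n : ℝ) + 1 ≤ R ∧ s9PP g (Metric.ball 0 R) ∧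
      ‖deriv g 0‖ = 2 + 2 * ‖g 0‖ ^ 2 ∧
      ∀ ζ ∈ Metric.ball (0:ℂ) (R / 2), ‖deriv g ζ‖ ≤ 2 + 8 * ‖g ζ‖ ^ 2 := by
    intro n
    obtain ⟨u, c, ρ, hρ, hu, hbad⟩ := hcon (8 * ((n : ℝ) + 1) ^ 2) (by positivity)
    obtain ⟨g, R, hR, hR2, h⟩ := s9_renorm hρ (by positivity) hu hbad
    refine ⟨g, R, ?_, h⟩
    have : ((n : ℝ) + 1) ^ 2 ≤ R ^ 2 := by linarith
    exact (sq_le_sq₀ (by positivity) hR.le).1 this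
  choose g R hR hPP h0 hb using hex
  have hRpos : ∀ n, 0 < R n := fun n => lt_of_lt_of_le (by positivity) (hR n)
  have hR1 : ∀ n, 1 ≤ R n := fun n => le_trans (by simp) (hR n)
  have hc : ∀ n, ‖g n 0‖ ≤ 256 := fun n => s9_center_bound (hR1 n) (hPP n).1 (h0 n) (hb n)
  have hsubR : ∀ n, Metric.ball (0:ℂ) (R n / 4) ⊆ Metric.ball 0 (R n) := fun n =>
    Metric.ball_subset_ball (by linarith [hRpos n])
  set l : Ultrafilter ℕ := Filter.hyperfilter ℕ with hl
  have hle : (l : Filter ℕ) ≤ atTop := by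
    rw [← Nat.cofinite_eq_atTop]; exact Filter.hyperfilter_le_cofinite
  have hRt : Tendsto (fun n => R n / 4) atTop atTop := by
    apply Tendsto.atTop_div_const (by norm_num)
    exact tendsto_atTop_mono (fun n => (by linarith [hR n] : (n:ℝ) ≤ R n)) tendsto_natCast_atTop_atTop
  obtain ⟨U, hUd, hloc, hlocd⟩ := s9_montel (g := g) hRt
    (fun n => (hPP n).1.mono (hsubR n)) (B := fun t => 256 * Real.exp (5000 * t))
    (by intro a b hab; simp only; gcongr)
    (fun n z hz => s9_growth (hPP n).1 (hc n) (hRpos n) (hb n) hz) l hle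
  have hRl : ∀ k : ℝ, ∀ᶠ n in (l : Filter ℕ), k < R n / 4 := fun k =>
    hle (hRt.eventually (eventually_gt_atTop k))
  have hUdd : Differentiable ℂ (deriv U) := fun z =>
    (hUd.differentiableOn.deriv isOpen_univ).differentiableAt Filter.univ_mem
  have hpt : ∀ z, Tendsto (fun n => g n z) l (𝓝 (U z)) := fun z =>
    (hloc.tendstoLocallyUniformlyOn (s := Set.univ)).tendsto_at trivial
  have hptd : ∀ z, Tendsto (fun n => deriv (g n) z) l (𝓝 (deriv U z)) := fun z =>
    (hlocd.tendstoLocallyUniformlyOn (s := Set.univ)).tendsto_at trivial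
  have hU2 : 2 ≤ ‖deriv U 0‖ := by
    refine ge_of_tendsto (hptd 0).norm (Eventually.of_forall fun n => ?_)
    rw [h0 n]; have := sq_nonneg ‖g n 0‖; linarith
  have hevd : ∀ z0 : ℂ, ∀ᶠ n in (l : Filter ℕ), Metric.ball z0 1 ⊆ Metric.ball 0 (R n) := by
    intro z0
    filter_upwards [hRl (‖z0‖ + 1)] with n hn
    intro y hy
    have h1 : ‖y - z0‖ < 1 := by simpa [dist_eq_norm] using hy
    have h2 := norm_le_norm_sub_add y z0
    have := hRpos n
    simp only [Metric.mem_ball, dist_zero_right]; linarith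
  refine s9_no_limit (U := U) (A := 256) (B := 5000) ⟨hUd.differentiableOn, fun z0 _ => ⟨?_, ?_⟩⟩
    (by norm_num) (by norm_num) ?_ hU2
  · intro h1
    have hloc1 : TendstoLocallyUniformly (fun n z => deriv (g n) z - 1) (fun z => deriv U z - 1) l := by
      rw [Metric.tendstoLocallyUniformly_iff] at hlocd ⊢
      simpa [dist_eq_norm] using hlocd
    have := s9_hurwitz (hUdd.sub_const 1) hloc1 (z0 := z0) one_pos (by
      filter_upwards [hevd z0] with n hn
      exact (((hPP n).1.deriv Metric.isOpen_ball).mono hn).sub_const 1) (by simp only [h1, sub_self])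
      ⟨0, by
        intro h
        have h2 : deriv U 0 = 1 := by linear_combination h
        rw [h2] at hU2; norm_num at hU2⟩ (1/2) (by norm_num)
    obtain ⟨n, ⟨w, hw, hw0⟩, hn⟩ := (this.and (hevd z0)).exists
    refine ((hPP n).2 w (hn (Metric.closedBall_subset_ball (by norm_num) hw))).1 ?_
    linear_combination hw0
  · intro hz0
    have hne : ∃ w, U w ≠ 0 := by
      by_contra hall
      push Not at hall
      have : U = fun _ => 0 := funext hall
      rw [this] at hU2
      simp at hU2
      linarith
    have hcl : IsClosed {v : ℂ | v.im = 0 ∧ -1 ≤ v.re ∧ v.re ≤ 0} :=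
      (isClosed_eq Complex.continuous_im continuous_const).inter
        ((isClosed_le continuous_const Complex.continuous_re).inter
          (isClosed_le Complex.continuous_re continuous_const))
    have hmem : deriv U z0 ∈ closure {v : ℂ | v.im = 0 ∧ -1 ≤ v.re ∧ v.re ≤ 0} := by
      rw [Metric.mem_closure_iff]
      intro ε hε
      obtain ⟨t, ht, htn⟩ := (Metric.tendstoLocallyUniformly_iff.1 hlocd) (ε / 2) (by positivity) z0
      have hcont : ∀ᶠ w in 𝓝 z0, dist (deriv U w) (deriv U z0) < ε / 2 :=
        (Metric.tendsto_nhds.1 hUdd.continuous.continuousAt) (ε / 2) (by positivity)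
      obtain ⟨δ, hδ, hδs⟩ := Metric.mem_nhds_iff.1 (Filter.inter_mem ht hcont)
      have := s9_hurwitz hUd hloc (z0 := z0) one_pos (by
        filter_upwards [hevd z0] with n hn
        exact (hPP n).1.mono hn) hz0 hne (min (1/2) (δ / 2)) (by positivity)
      obtain ⟨n, ⟨⟨w, hw, hw0⟩, hn⟩, hclose⟩ := ((this.and (hevd z0)).and htn).exists
      have hw1 : w ∈ Metric.ball z0 1 :=
        Metric.closedBall_subset_ball (lt_of_le_of_lt (min_le_left _ _) (by norm_num)) hw
      have hwδ : w ∈ Metric.ball z0 δ :=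
        Metric.closedBall_subset_ball (lt_of_le_of_lt (min_le_right _ _) (by linarith)) hw
      have hh := hδs hwδ
      refine ⟨deriv (g n) w, ((hPP n).2 w (hn hw1)).2 hw0, ?_⟩
      have h3 := hclose w hh.1
      have h4 : dist (deriv U w) (deriv U z0) < ε / 2 := hh.2
      have := dist_triangle (deriv U z0) (deriv U w) (deriv (g n) w)
      rw [dist_comm] at h4
      linarith
    rw [hcl.closure_eq] at hmem
    exact hmem
  · intro z
    refine le_of_tendsto (hpt z).norm ?_
    filter_upwards [hRl ‖z‖] with n hn
    exact s9_growth (hPP n).1 (hc n) (hRpos n) (hb n) (by simpa using hn)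


/-! ### Part 5: growth along paths in the half plane -/

/-- The weight used in the growth estimates. -/
noncomputable def s9W (z : ℂ) : ℝ := ‖z‖ ^ (7/2 : ℝ) * z.im ^ (-(7/4) : ℝ)

theorem s9_im_le {z : ℂ} : z.im ≤ ‖z‖ := (le_abs_self _).trans (Complex.abs_im_le_norm z)

theorem s9W_ge_im {z : ℂ} (hy : 0 < z.im) (hr : 1 ≤ ‖z‖) : z.im ≤ s9W z := by
  have h1 : z.im ^ (11/4 : ℝ) ≤ ‖z‖ ^ (7/2 : ℝ) := by
    calc z.im ^ (11/4 : ℝ) ≤ ‖z‖ ^ (11/4 : ℝ) :=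
          Real.rpow_le_rpow hy.le s9_im_le (by norm_num)
      _ ≤ _ := Real.rpow_le_rpow_of_exponent_le hr (by norm_num)
  calc z.im = z.im ^ (11/4 : ℝ) * z.im ^ (-(7/4) : ℝ) := by
        rw [← Real.rpow_add hy]; norm_num
    _ ≤ _ := by unfold s9W; gcongr

theorem s9W_ge_inv {z : ℂ} (hy : 0 < z.im) (hr : 1 ≤ ‖z‖) : z.im ^ (-(7/4) : ℝ) ≤ s9W z := by
  have : 1 ≤ ‖z‖ ^ (7/2 : ℝ) := Real.one_le_rpow hr (by norm_num)
  have h2 : 0 ≤ z.im ^ (-(7/4) : ℝ) := by positivity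
  unfold s9W
  nlinarith

theorem s9W_ge_one {z : ℂ} (hy : 0 < z.im) (hr : 1 ≤ ‖z‖) : 1 ≤ s9W z := by
  rcases le_total 1 z.im with h | h
  · exact h.trans (s9W_ge_im hy hr)
  · refine le_trans ?_ (s9W_ge_inv hy hr)
    exact Real.one_le_rpow_of_pos_of_le_one_of_nonpos hy h (by norm_num)

theorem s9W_ge_log {z : ℂ} (hy : 0 < z.im) (hr : 1 ≤ ‖z‖) : -Real.log z.im ≤ s9W z := by
  refine le_trans ?_ (s9W_ge_inv hy hr)
  have h1 := Real.log_le_sub_one_of_pos (show 0 < z.im ^ (-(7/4) : ℝ) by positivity)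
  rw [Real.log_rpow hy] at h1
  rcases le_total 1 z.im with h | h
  · have := Real.log_nonneg h
    have : 0 ≤ z.im ^ (-(7/4) : ℝ) := by positivity
    linarith
  · have := Real.log_nonpos hy.le h
    linarith

theorem s9_path_deriv {s : ℂ → ℝ} {p v : ℂ} {τ : ℝ} {d : ℝ}
    (h : HasDerivAt (fun t : ℝ => s (p + τ * v + t * v)) d 0) :
    HasDerivAt (fun t : ℝ => s (p + t * v)) d τ := by
  have h1 : HasDerivAt (fun t : ℝ => s (p + τ * v + t * v)) d (τ - τ) := by simpa using h
  have h2 := h1.comp_sub_const τ τ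
  have e : (fun t : ℝ => s (p + τ * v + ((t - τ : ℝ) : ℂ) * v)) = fun t : ℝ => s (p + t * v) := by
    funext t
    congr 1
    push_cast; ring
  rw [e] at h2
  exact h2

theorem s9_fence {s : ℂ → ℝ} {p v : ℂ} {b : ℝ} {B B' : ℝ → ℝ}
    (hs : ∀ t ∈ Set.Icc 0 b, ∃ d, HasDerivAt (fun τ : ℝ => s (p + t * v + τ * v)) d 0 ∧
      (|s (p + t * v)| = B t → |d| < B' t))
    (h0 : |s p| ≤ B 0) (hB : ∀ t ∈ Set.Icc 0 b, HasDerivAt B (B' t) t) :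
    ∀ t ∈ Set.Icc 0 b, |s (p + t * v)| ≤ B t := by
  choose! d hd1 hd2 using hs
  intro t ht
  have := image_norm_le_of_norm_deriv_right_lt_deriv_boundary' (f := fun t : ℝ => s (p + t * v))
    (f' := d) (a := 0) (b := b) (B := B) (B' := B')
    (fun t ht => (s9_path_deriv (hd1 t ht)).continuousAt.continuousWithinAt)
    (fun t ht => (s9_path_deriv (hd1 t ⟨ht.1, ht.2.le⟩)).hasDerivWithinAt)
    (by simpa using h0)
    (fun t ht => (hB t ht).continuousAt.continuousWithinAt)
    (fun t ht => (hB t ⟨ht.1, ht.2.le⟩).hasDerivWithinAt)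
    (fun t ht h => hd2 t ⟨ht.1, ht.2.le⟩ h)
  exact this ht

theorem s9_lemmaG {s : ℂ → ℝ} {R1 D : ℝ} (hR1 : 1 ≤ R1) (hD : 0 ≤ D)
    (hs : ∀ z : ℂ, 0 < z.im → R1 < ‖z‖ → ∀ v : ℂ, ‖v‖ = 1 →
      ∃ d, HasDerivAt (fun t : ℝ => s (z + t * v)) d 0 ∧
        |d| ≤ 3 / 2 / z.im * (D * s9W z + |s z|)) :
    ∃ E, 0 ≤ E ∧ ∀ z : ℂ, 0 < z.im → R1 + 1 ≤ ‖z‖ → |s z| ≤ E * s9W z := by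
  set y0 := R1 + 1 with hy0
  have hy0pos : 0 < y0 := by linarith
  set E := 24 * D + 1 + |s (y0 * Complex.I)| with hE
  have hEpos : 0 < E := by positivity
  -- vertical path upwards
  have hup : ∀ r : ℝ, y0 ≤ r → |s (r * Complex.I)| ≤ E * r ^ (7/4 : ℝ) := by
    intro r hr
    have key := s9_fence (s := s) (p := y0 * Complex.I) (v := Complex.I) (b := r - y0)
      (B := fun t => E * (y0 + t) ^ (7/4 : ℝ)) (B' := fun t => E * (7/4 * (y0 + t) ^ (3/4 : ℝ)))
      ?_ ?_ ?_ (r - y0) ⟨by linarith, le_refl _⟩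
    · simp only [add_sub_cancel] at key
      have e : (y0 : ℂ) * Complex.I + ((r - y0 : ℝ) : ℂ) * Complex.I = r * Complex.I := by
        push_cast; ring
      rwa [e] at key
    · intro t ht
      have e : (y0 : ℂ) * Complex.I + t * Complex.I = ((y0 + t : ℝ) : ℂ) * Complex.I := by
        push_cast; ring
      rw [e]
      have htp : 0 < y0 + t := by linarith [ht.1]
      have him : (((y0 + t : ℝ) : ℂ) * Complex.I).im = y0 + t := by simp
      have hn : ‖((y0 + t : ℝ) : ℂ) * Complex.I‖ = y0 + t := by
        rw [norm_mul, Complex.norm_real, Complex.norm_I, mul_one, Real.norm_of_nonneg htp.le]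
      obtain ⟨d, hd, hdle⟩ := hs (((y0 + t : ℝ) : ℂ) * Complex.I) (by rw [him]; exact htp)
        (by rw [hn]; linarith [ht.1]) Complex.I Complex.norm_I
      refine ⟨d, hd, fun hEq => ?_⟩
      have hW : s9W (((y0 + t : ℝ) : ℂ) * Complex.I) = (y0 + t) ^ (7/4 : ℝ) := by
        unfold s9W
        rw [him, hn, ← Real.rpow_add htp]; norm_num
      rw [hW, hEq, him] at hdle
      have e2 : (y0 + t) ^ (7/4 : ℝ) = (y0 + t) * (y0 + t) ^ (3/4 : ℝ) := by
        rw [← Real.rpow_one_add' htp.le (by norm_num)]; norm_num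
      rw [e2] at hdle
      have e3 : 3 / 2 / (y0 + t) * (D * ((y0 + t) * (y0 + t) ^ (3/4 : ℝ)) +
          E * ((y0 + t) * (y0 + t) ^ (3/4 : ℝ))) = 3 / 2 * (D + E) * (y0 + t) ^ (3/4 : ℝ) := by
        field_simp
      rw [e3] at hdle
      have hp : 0 < (y0 + t) ^ (3/4 : ℝ) := by positivity
      have hcoef : 3 / 2 * (D + E) < E * (7/4) := by
        have := abs_nonneg (s (y0 * Complex.I)); linarith
      calc |d| ≤ _ := hdle
        _ < E * (7/4) * (y0 + t) ^ (3/4 : ℝ) := by gcongr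
        _ = _ := by ring
    · simp only [add_zero]
      have h1 : 1 ≤ y0 ^ (7/4 : ℝ) := Real.one_le_rpow (by linarith) (by norm_num)
      have h2 : |s (y0 * Complex.I)| ≤ E := by rw [hE]; linarith
      nlinarith
    · intro t ht
      have htp : 0 < y0 + t := by linarith [ht.1]
      have h1 : HasDerivAt (fun t : ℝ => y0 + t) 1 t := (hasDerivAt_id t).const_add y0
      have h2 := (h1.rpow_const (p := 7/4) (Or.inl htp.ne')).const_mul E
      exact h2.congr_deriv (by norm_num)
  -- bound on W near the path
  have hWle : ∀ (z : ℂ) (r : ℝ), 0 < r → 0 < z.im → z.im ≤ r → |z.re| ≤ r →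
      s9W z ≤ 4 * (r ^ (7/2 : ℝ) * z.im ^ (-(7/4) : ℝ)) := by
    intro z r hr hy hyr hxr
    have h1 : ‖z‖ ≤ Real.sqrt 2 * r := by
      have h2 : ‖z‖ ^ 2 ≤ (Real.sqrt 2 * r) ^ 2 := by
        rw [mul_pow, Real.sq_sqrt (by norm_num), ← Complex.normSq_eq_norm_sq, Complex.normSq_apply]
        have := abs_le.1 hxr
        nlinarith
      exact (sq_le_sq₀ (norm_nonneg _) (by positivity)).1 h2
    have h2 : ‖z‖ ^ (7/2 : ℝ) ≤ 4 * r ^ (7/2 : ℝ) := by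
      calc ‖z‖ ^ (7/2 : ℝ) ≤ (Real.sqrt 2 * r) ^ (7/2 : ℝ) :=
            Real.rpow_le_rpow (norm_nonneg _) h1 (by norm_num)
        _ = Real.sqrt 2 ^ (7/2 : ℝ) * r ^ (7/2 : ℝ) := Real.mul_rpow (by positivity) hr.le
        _ ≤ 4 * r ^ (7/2 : ℝ) := by
          gcongr
          calc Real.sqrt 2 ^ (7/2 : ℝ) ≤ Real.sqrt 2 ^ (4 : ℝ) := by
                apply Real.rpow_le_rpow_of_exponent_le _ (by norm_num)
                rw [Real.one_le_sqrt]; norm_num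
            _ = (Real.sqrt 2 ^ 2) ^ 2 := by
                rw [← pow_mul]; norm_cast
            _ = 4 := by rw [Real.sq_sqrt (by norm_num)]; norm_num
    unfold s9W
    rw [← mul_assoc]
    gcongr
  -- horizontal path
  have hhor : ∀ (r : ℝ) (σ : ℂ), (σ = 1 ∨ σ = -1) → y0 ≤ r → ∀ x : ℝ, 0 ≤ x → x ≤ r →
      |s (r * Complex.I + x * σ)| ≤ E * Real.exp 2 * r ^ (7/4 : ℝ) := by
    intro r σ hσ hr x hx0 hxr
    have hrp : 0 < r := by linarith
    have hσn : ‖σ‖ = 1 := by rcases hσ with rfl | rfl <;> simp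
    have hσim : σ.im = 0 := by rcases hσ with rfl | rfl <;> simp
    have hσre : |σ.re| = 1 := by rcases hσ with rfl | rfl <;> simp
    have key := s9_fence (s := s) (p := r * Complex.I) (v := σ) (b := x)
      (B := fun t => E * r ^ (7/4 : ℝ) * Real.exp (2 / r * t))
      (B' := fun t => E * r ^ (7/4 : ℝ) * (Real.exp (2 / r * t) * (2 / r)))
      ?_ ?_ ?_ x ⟨hx0, le_refl _⟩
    · refine key.trans ?_
      have : Real.exp (2 / r * x) ≤ Real.exp 2 := by
        apply Real.exp_le_exp.2
        rw [div_mul_eq_mul_div, div_le_iff₀ hrp]; linarith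
      calc E * r ^ (7/4 : ℝ) * Real.exp (2 / r * x) ≤ E * r ^ (7/4 : ℝ) * Real.exp 2 := by gcongr
        _ = _ := by ring
    · intro t ht
      set z : ℂ := r * Complex.I + t * σ with hz
      have him : z.im = r := by simp [hz, hσim]
      have hre : |z.re| = t := by
        have : z.re = t * σ.re := by simp [hz]
        rw [this, abs_mul, hσre, mul_one, abs_of_nonneg ht.1]
      have hn : r ≤ ‖z‖ := by rw [← him]; exact s9_im_le
      obtain ⟨d, hd, hdle⟩ := hs z (by rw [him]; exact hrp) (by linarith) σ hσn
      refine ⟨d, hd, fun hEq => ?_⟩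
      have hW := hWle z r hrp (by rw [him]; exact hrp) him.le (by rw [hre]; linarith [ht.2])
      rw [him, ← Real.rpow_add hrp] at hW
      norm_num at hW
      rw [hEq, him] at hdle
      have h1 : 1 ≤ Real.exp (2 / r * t) := Real.one_le_exp (by have := ht.1; positivity)
      set e := Real.exp (2 / r * t)
      have hp : 0 < r ^ (7/4 : ℝ) := by positivity
      calc |d| ≤ _ := hdle
        _ ≤ 3 / 2 / r * (D * (4 * r ^ (7/4 : ℝ)) + E * r ^ (7/4 : ℝ) * e) := by gcongr
        _ = 3 / 2 * (4 * D + E * e) * (r ^ (7/4 : ℝ) / r) := by field_simp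
        _ < (E * e * 2) * (r ^ (7/4 : ℝ) / r) := by
          have hcoef : 3 / 2 * (4 * D + E * e) < E * e * 2 := by
            have := abs_nonneg (s (y0 * Complex.I))
            nlinarith
          gcongr
        _ = _ := by field_simp
    · simp only [mul_zero, Real.exp_zero, mul_one]
      exact hup r hr
    · intro t ht
      have h1 : HasDerivAt (fun t : ℝ => 2 / r * t) (2 / r) t := by
        simpa using (hasDerivAt_id t).const_mul (2 / r)
      exact h1.exp.const_mul _
  -- vertical path downwards
  set E2 := E * Real.exp 2 with hE2
  have hE2E : E ≤ E2 := by
    have : 1 ≤ Real.exp 2 := Real.one_le_exp (by norm_num)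
    nlinarith
  refine ⟨E2, by positivity, fun z hy hr => ?_⟩
  set r := ‖z‖ with hrdef
  have hrp : 0 < r := by linarith
  have hyr : z.im ≤ r := s9_im_le
  have hxr : |z.re| ≤ r := Complex.abs_re_le_norm z
  set q : ℂ := z.re + r * Complex.I with hq
  have hsq : |s q| ≤ E2 * r ^ (7/4 : ℝ) := by
    rcases le_total 0 z.re with h | h
    · have := hhor r 1 (Or.inl rfl) hr z.re h (by rwa [abs_of_nonneg h] at hxr)
      rwa [mul_one, add_comm] at this
    · have := hhor r (-1) (Or.inr rfl) hr (-z.re) (by linarith) (by rwa [abs_of_nonpos h] at hxr)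
      have e : (r : ℂ) * Complex.I + ((-z.re : ℝ) : ℂ) * -1 = q := by rw [hq]; push_cast; ring
      rwa [e] at this
  have key := s9_fence (s := s) (p := q) (v := -Complex.I) (b := r - z.im)
      (B := fun t => E2 * r ^ (7/2 : ℝ) * (r - t) ^ (-(7/4) : ℝ))
      (B' := fun t => E2 * r ^ (7/2 : ℝ) * (7/4 * (r - t) ^ (-(11/4) : ℝ)))
      ?_ ?_ ?_ (r - z.im) ⟨by linarith, le_refl _⟩
  · have e : q + ((r - z.im : ℝ) : ℂ) * -Complex.I = z := by
      apply Complex.ext <;> simp [hq]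
    rw [e] at key
    simp only [sub_sub_cancel] at key
    unfold s9W
    rw [← mul_assoc]
    exact key
  · intro t ht
    set w : ℂ := q + t * -Complex.I with hw
    have him : w.im = r - t := by simp [hw, hq]; ring
    have hre : w.re = z.re := by simp [hw, hq]
    have htp : 0 < r - t := by linarith [ht.2]
    have hnw : r ≤ ‖w‖ := by
      rw [hrdef, ← sq_le_sq₀ (norm_nonneg _) (norm_nonneg _), ← Complex.normSq_eq_norm_sq,
        ← Complex.normSq_eq_norm_sq, Complex.normSq_apply, Complex.normSq_apply, hre, him]
      have : z.im ≤ r - t := by linarith [ht.2]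
      nlinarith
    obtain ⟨d, hd, hdle⟩ := hs w (by rw [him]; exact htp) (by linarith) (-Complex.I) (by simp)
    refine ⟨d, hd, fun hEq => ?_⟩
    have hW := hWle w r hrp (by rw [him]; exact htp) (by rw [him]; linarith [ht.1])
      (by rw [hre]; exact hxr)
    rw [him] at hW
    rw [hEq, him] at hdle
    have e2 : (r - t) ^ (-(7/4) : ℝ) = (r - t) * (r - t) ^ (-(11/4) : ℝ) := by
      rw [← Real.rpow_one_add' htp.le (by norm_num)]; norm_num
    rw [e2] at hW hdle
    set X := (r - t) ^ (-(11/4) : ℝ) with hX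
    have hXp : 0 < X := by positivity
    set Y := r ^ (7/2 : ℝ) with hY
    have hYp : 0 < Y := by positivity
    calc |d| ≤ _ := hdle
      _ ≤ 3 / 2 / (r - t) * (D * (4 * (Y * ((r - t) * X))) + E2 * Y * ((r - t) * X)) := by gcongr
      _ = 3 / 2 * (4 * D + E2) * (Y * X) := by field_simp
      _ < (E2 * (7/4)) * (Y * X) := by
        have hcoef : 3 / 2 * (4 * D + E2) < E2 * (7/4) := by
          have := abs_nonneg (s (y0 * Complex.I))
          linarith
        gcongr
      _ = _ := by ring
  · simp only [sub_zero]
    rw [mul_assoc, ← Real.rpow_add hrp]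
    norm_num
    exact hsq
  · intro t ht
    have htp : 0 < r - t := by linarith [ht.2]
    have h1 : HasDerivAt (fun t : ℝ => r - t) (-1) t := (hasDerivAt_id t).const_sub r
    have h2 := (h1.rpow_const (p := -(7/4)) (Or.inl htp.ne')).const_mul (E2 * r ^ (7/2 : ℝ))
    exact h2.congr_deriv (by norm_num)


/-! ### Part 6: half plane growth of functions in the class -/

theorem s9_chain (C1 : ℝ) (hC1 : 0 ≤ C1) : ∃ L : ℝ, 0 < L ∧ ∀ (u : ℂ → ℂ) (z1 z : ℂ) (y : ℝ), 0 < y →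
    (∀ t ∈ Set.Icc (0:ℝ) 1, DifferentiableOn ℂ u (Metric.ball (z1 + t * (z - z1)) (2 * (0.04 * y))) ∧
      ∀ w ∈ Metric.ball (z1 + t * (z - z1)) (2 * (0.04 * y)), ‖deriv u w‖ ≤ 2 + C1 * ‖u w‖ ^ 2 / y ^ 2) →
    ‖z - z1‖ ≤ 2.9 * y → ‖u z1‖ ≤ y → ‖u z‖ ≤ L * y := by
  set lam : ℕ → ℝ := fun n => Nat.rec 1 (fun _ l => l * Real.exp (0.058 * (2 + C1 * l ^ 2) / l)) n
    with hlam
  have hl0 : lam 0 = 1 := rfl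
  have hls : ∀ k, lam (k+1) = lam k * Real.exp (0.058 * (2 + C1 * lam k ^ 2) / lam k) := fun k => rfl
  have hlp : ∀ k, 0 < lam k := by
    intro k
    induction k with
    | zero => rw [hl0]; norm_num
    | succ k ih => rw [hls]; positivity
  refine ⟨lam 100, hlp 100, ?_⟩
  intro u z1 z y hy hu hz h1
  have key : ∀ k : ℕ, k ≤ 100 → ‖u (z1 + ((k / 100 : ℝ) : ℂ) * (z - z1))‖ ≤ lam k * y := by
    intro k
    induction k with
    | zero => intro _; simpa [hl0] using h1
    | succ k ih =>
      intro hk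
      have ih' := ih (by omega)
      have hk' : (k : ℝ) + 1 ≤ 100 := by exact_mod_cast hk
      obtain ⟨hd, hb⟩ := hu (k/100 : ℝ) ⟨by positivity, by linarith⟩
      have hdist : dist (z1 + (((k+1 : ℕ) / 100 : ℝ) : ℂ) * (z - z1)) (z1 + ((k / 100 : ℝ) : ℂ) * (z - z1))
          ≤ 0.029 * y := by
        rw [dist_eq_norm]
        have : z1 + (((k+1 : ℕ) / 100 : ℝ) : ℂ) * (z - z1) - (z1 + ((k / 100 : ℝ) : ℂ) * (z - z1))
          = ((1/100 : ℝ) : ℂ) * (z - z1) := by push_cast; ring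
        rw [this, norm_mul, Complex.norm_real]
        norm_num at hz ⊢
        linarith
      have hl := hlp k
      have H := s9_hopf (u := u) (w0 := z1 + ((k / 100 : ℝ) : ℂ) * (z - z1)) (s := 0.04 * y)
        (Λ := lam k * y) (D := 2 + C1 * lam k ^ 2) (by positivity) (by positivity) hd ih' ?_
        (z := z1 + (((k+1 : ℕ) / 100 : ℝ) : ℂ) * (z - z1)) ?_
      · refine H.trans ?_
        rw [hls]
        have : 2 * (2 + C1 * lam k ^ 2) * dist (z1 + (((k+1 : ℕ) / 100 : ℝ) : ℂ) * (z - z1)) (z1 + ((k / 100 : ℝ) : ℂ) * (z - z1)) / (lam k * y) ≤ 0.058 * (2 + C1 * lam k ^ 2) / lam k := by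
          calc _ ≤ 2 * (2 + C1 * lam k ^ 2) * (0.029 * y) / (lam k * y) := by gcongr
            _ = _ := by field_simp; ring
        calc _ ≤ lam k * y * Real.exp (0.058 * (2 + C1 * lam k ^ 2) / lam k) := by gcongr
          _ = _ := by ring
      · intro w hw hwe
        have := hb w hw
        rw [hwe] at this
        refine this.trans (le_of_eq ?_)
        field_simp
      · rw [Metric.mem_ball]
        refine lt_of_le_of_lt hdist ?_
        norm_num
        linarith
  have := key 100 le_rfl
  simpa using this

theorem s9_geom {z w : ℂ} {R0 : ℝ} (hR0 : 1 ≤ R0) (hy : 0 < z.im) (hr : 1000 * R0 < ‖z‖)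
    (hw : dist w (z + z.im * I) < 1.98 * z.im) : 0.02 * z.im < w.im ∧ 2 * R0 < ‖w‖ := by
  rw [dist_eq_norm] at hw
  have h1 : |(w - (z + z.im * I)).im| < 1.98 * z.im := (Complex.abs_im_le_norm _).trans_lt hw
  simp at h1
  rw [abs_lt] at h1
  have him : 0.02 * z.im < w.im := by norm_num at h1 ⊢; linarith [h1.1]
  refine ⟨him, ?_⟩
  rcases le_total (‖z‖ / 10) z.im with h | h
  · have := s9_im_le (z := w)
    norm_num at him
    linarith
  · have h2 : ‖z‖ ≤ ‖w‖ + ‖w - (z + z.im * I)‖ + ‖(z.im : ℂ) * I‖ := by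
      calc ‖z‖ = ‖w - (w - (z + z.im * I)) - (z.im : ℂ) * I‖ := by congr 1; ring
        _ ≤ _ := (norm_sub_le _ _).trans (by gcongr; exact norm_sub_le _ _)
    have h3 : ‖(z.im : ℂ) * I‖ = z.im := by simp [abs_of_pos hy]
    rw [h3] at h2
    norm_num at hw
    linarith

theorem s9_dichotomy : ∃ C1 L : ℝ, 0 < C1 ∧ 0 < L ∧ ∀ (u : ℂ → ℂ) (R0 : ℝ), 1 ≤ R0 →
    s9PP u {z | 0 < z.im ∧ R0 < ‖z‖} →
    (∀ z : ℂ, 0 < z.im → 2 * R0 < ‖z‖ → ‖deriv u z‖ ≤ 2 + C1 * ‖u z‖ ^ 2 / z.im ^ 2) ∧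
    ∀ z : ℂ, 0 < z.im → 1000 * R0 < ‖z‖ → ‖u z‖ ≤ L * z.im ∨
      (z.im < ‖u z‖ ∧ ‖deriv u z‖ ≤ 3/2/z.im * ‖u z‖ * Real.log (‖u z‖ / z.im)) := by
  obtain ⟨C, hC, hN⟩ := s9_theoremN
  obtain ⟨L, hL, hchain⟩ := s9_chain (2500 * (4 * C)) (by positivity)
  refine ⟨4 * C, L, by positivity, hL, ?_⟩
  intro u R0 hR0 hu
  have star : ∀ z : ℂ, 0 < z.im → 2 * R0 < ‖z‖ →
      ‖deriv u z‖ ≤ 2 + 4 * C * ‖u z‖ ^ 2 / z.im ^ 2 := by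
    intro z hy hr
    have hsub : Metric.ball z (z.im / 2) ⊆ {z | 0 < z.im ∧ R0 < ‖z‖} := by
      intro w hw
      rw [Metric.mem_ball, dist_eq_norm] at hw
      have h1 : |(w - z).im| < z.im / 2 := (Complex.abs_im_le_norm _).trans_lt hw
      rw [Complex.sub_im, abs_lt] at h1
      have h2 := norm_sub_norm_le z w
      rw [norm_sub_rev] at h2
      have := s9_im_le (z := z)
      exact ⟨by linarith [h1.1], by linarith⟩
    have := hN u z (z.im/2) (by positivity) ⟨hu.1.mono hsub, fun w hw => hu.2 w (hsub hw)⟩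
    refine this.trans (le_of_eq ?_)
    field_simp
    ring
  refine ⟨star, ?_⟩
  intro z hy hr
  have hzc : dist z (z + z.im * I) = z.im := by
    simp [dist_eq_norm, abs_of_pos hy]
  have hgeom := fun w hw => s9_geom (w := w) hR0 hy hr hw
  have hdiff : DifferentiableOn ℂ u (Metric.ball (z + z.im * I) (1.98 * z.im)) := by
    refine hu.1.mono fun w hw => ?_
    have := hgeom w hw
    refine ⟨?_, ?_⟩
    · refine lt_trans ?_ this.1; positivity
    · linarith [this.2]
  by_cases hcase : ∃ z1 ∈ Metric.ball (z + z.im * I) (1.9 * z.im), ‖u z1‖ ≤ z.im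
  · left
    obtain ⟨z1, hz1, hz1u⟩ := hcase
    rw [Metric.mem_ball] at hz1
    refine hchain u z1 z z.im hy ?_ ?_ hz1u
    · intro t ht
      have hconv : z1 + t * (z - z1) ∈ Metric.ball (z + z.im * I) (1.9 * z.im) := by
        have := (convex_ball (z + z.im * I) (1.9 * z.im)).add_smul_sub_mem (x := z1) (y := z) hz1 (by
          rw [Metric.mem_ball, hzc]; norm_num; linarith) ht
        simpa using this
      have hss : ∀ w ∈ Metric.ball (z1 + t * (z - z1)) (2 * (0.04 * z.im)),
          w ∈ Metric.ball (z + z.im * I) (1.98 * z.im) := by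
        intro w hw
        rw [Metric.mem_ball] at hw hconv ⊢
        have := dist_triangle w (z1 + t * (z - z1)) (z + z.im * I)
        norm_num at hw hconv ⊢
        linarith
      refine ⟨hdiff.mono hss, ?_⟩
      intro w hw
      obtain ⟨g1, g2⟩ := hgeom w (hss w hw)
      have hwp : 0 < w.im := lt_trans (by positivity) g1
      refine (star w hwp g2).trans ?_
      have : 4 * C * ‖u w‖ ^ 2 / w.im ^ 2 ≤ 4 * C * ‖u w‖ ^ 2 / (0.02 * z.im) ^ 2 := by
        gcongr
      refine (add_le_add le_rfl this).trans (le_of_eq ?_)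
      norm_num
      field_simp
      norm_num
    · rw [← dist_eq_norm]
      have := dist_triangle_right z z1 (z + z.im * I)
      norm_num at hz1 ⊢
      linarith
  · right
    push Not at hcase
    have hzB : z ∈ Metric.ball (z + z.im * I) (1.9 * z.im) := by
      rw [Metric.mem_ball, hzc]; norm_num; linarith
    have hBB : Metric.ball (z + z.im * I) (1.9 * z.im) ⊆ Metric.ball (z + z.im * I) (1.98 * z.im) := by
      apply Metric.ball_subset_ball; norm_num; linarith
    have hne : ∀ w ∈ Metric.ball (z + z.im * I) (1.9 * z.im), u w ≠ 0 := by
      intro w hw h0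
      have := hcase w hw
      rw [h0, norm_zero] at this
      linarith
    obtain ⟨F, hF1, hF2⟩ := s9_exists_log_ball (by positivity) (hdiff.mono hBB) hne
    have hre : ∀ w ∈ Metric.ball (z + z.im * I) (1.9 * z.im), (F w).re = Real.log ‖u w‖ := by
      intro w hw
      rw [← hF2 w hw, Complex.norm_exp, Real.log_exp]
    have hpos : ∀ w ∈ Metric.ball (z + z.im * I) (1.9 * z.im),
        0 < ((fun w => F w - (Real.log z.im : ℂ)) w).re := by
      intro w hw
      simp only [Complex.sub_re, Complex.ofReal_re, hre w hw]
      have := Real.log_lt_log hy (hcase w hw)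
      linarith
    have hder : ∀ w ∈ Metric.ball (z + z.im * I) (1.9 * z.im),
        HasDerivAt (fun w => F w - (Real.log z.im : ℂ)) (deriv u w / u w) w :=
      fun w hw => (hF1 w hw).sub_const _
    have H := s9_deriv_noncentral (φ := fun w => F w - (Real.log z.im : ℂ))
      (fun w hw => (hder w hw).differentiableAt.differentiableWithinAt) hpos hzB
    rw [(hder z hzB).deriv, ← dist_eq_norm, hzc] at H
    simp only [Complex.sub_re, Complex.ofReal_re, hre z hzB] at H
    have huz := hcase z hzB
    have hup : 0 < ‖u z‖ := hy.trans huz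
    refine ⟨huz, ?_⟩
    rw [Real.log_div hup.ne' hy.ne']
    set l := Real.log ‖u z‖ - Real.log z.im with hl
    have hlp : 0 < l := sub_pos.2 (Real.log_lt_log hy huz)
    rw [norm_div] at H
    have e1 : ‖deriv u z‖ / ‖u z‖ * (2.61 * z.im) ≤ 3.8 * l := by
      have : (‖deriv u z‖ / ‖u z‖ * (2.61 * z.im)) * z.im ≤ (3.8 * l) * z.im := by
        norm_num at H ⊢
        linarith
      exact le_of_mul_le_mul_right this hy
    have e2 : ‖deriv u z‖ / ‖u z‖ ≤ 3/2/z.im * l := by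
      rw [div_mul_eq_mul_div, le_div_iff₀ hy]
      norm_num at e1 ⊢
      linarith
    rw [div_le_iff₀ hup] at e2
    linarith


theorem s9_dir {u : ℂ → ℂ} {z v u' : ℂ} (h : HasDerivAt u u' z) :
    HasDerivAt (fun t : ℝ => u (z + t * v)) (u' * v) 0 := by
  have h1 : HasDerivAt (fun t : ℂ => z + t * v) v 0 := by
    simpa using ((hasDerivAt_id (0:ℂ)).mul_const v).const_add z
  have h2 : HasDerivAt u u' (z + 0 * v) := by simpa using h
  have h3 := HasDerivAt.comp (0:ℂ) h2 h1
  have h4 : HasDerivAt (u ∘ fun t : ℂ => z + t * v) (u' * v) ((0:ℝ):ℂ) := by simpa using h3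
  exact h4.comp_ofReal

theorem s9_isOpen (R0 : ℝ) : IsOpen {z : ℂ | 0 < z.im ∧ R0 < ‖z‖} :=
  (isOpen_lt continuous_const Complex.continuous_im).inter (isOpen_lt continuous_const continuous_norm)

theorem s9_growth1 {u : ℂ → ℂ} {R0 : ℝ} (hR0 : 1 ≤ R0) (hu : s9PP u {z | 0 < z.im ∧ R0 < ‖z‖}) :
    ∃ E R : ℝ, 0 ≤ E ∧ 1 ≤ R ∧ ∀ z : ℂ, 0 < z.im → R ≤ ‖z‖ → Real.log ‖1 - deriv u z‖ ≤ E * s9W z := by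
  obtain ⟨C1, L, hC1, hL, hdich⟩ := s9_dichotomy
  obtain ⟨star, dich⟩ := hdich u R0 hR0 hu
  have hG := s9_lemmaG (s := fun z => 1/2 * Real.log (1 + ‖u z‖ ^ 2)) (R1 := 1000 * R0)
    (D := 2 + C1 * L ^ 2 + 1) (by linarith) (by positivity) (by
    intro z hy hr v hv
    have hr1 : 1 ≤ ‖z‖ := by linarith
    have hz : z ∈ {z : ℂ | 0 < z.im ∧ R0 < ‖z‖} := ⟨hy, by linarith⟩
    have hd : HasDerivAt u (deriv u z) z :=
      (hu.1.differentiableAt ((s9_isOpen R0).mem_nhds hz)).hasDerivAt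
    have h1 := (s9_dir (v := v) hd).norm_sq
    have h2 := ((h1.const_add 1).log (by positivity)).const_mul (1/2 : ℝ)
    refine ⟨_, h2, ?_⟩
    simp only [Complex.ofReal_zero, zero_mul, add_zero]
    have hW := s9W_ge_im hy hr1
    have hW1 := s9W_ge_one hy hr1
    have hWl := s9W_ge_log hy hr1
    set a := ‖u z‖ with ha
    have ha0 : 0 ≤ a := norm_nonneg _
    have hin : |1/2 * (2 * inner ℝ (u z) (deriv u z * v) / (1 + a ^ 2))| ≤ a * ‖deriv u z‖ / (1 + a^2) := by
      rw [show 1/2 * (2 * inner ℝ (u z) (deriv u z * v) / (1 + a ^ 2)) =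
        inner ℝ (u z) (deriv u z * v) / (1 + a ^ 2) by ring, abs_div,
        abs_of_pos (show 0 < 1 + a^2 by positivity)]
      gcongr
      refine (abs_real_inner_le_norm _ _).trans ?_
      rw [norm_mul, hv, mul_one]
    refine hin.trans ?_
    have hs0 : 0 ≤ 1/2 * Real.log (1 + a ^ 2) := by
      have := Real.log_nonneg (show 1 ≤ 1 + a ^2 by nlinarith [sq_nonneg a])
      linarith
    rw [abs_of_nonneg hs0]
    rcases dich z hy hr with h | ⟨h, h'⟩
    · have hst := star z hy (by linarith)
      have h3 : ‖deriv u z‖ ≤ 2 + C1 * L ^ 2 := by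
        refine hst.trans ?_
        have : C1 * a ^ 2 / z.im ^ 2 ≤ C1 * (L * z.im) ^ 2 / z.im ^ 2 := by gcongr
        refine (add_le_add le_rfl this).trans (le_of_eq ?_)
        field_simp
      set C2 := 2 + C1 * L ^ 2 with hC2
      have hC2p : 0 < C2 := by positivity
      have h4 : a * ‖deriv u z‖ / (1 + a^2) ≤ C2 := by
        rw [div_le_iff₀ (by positivity)]
        nlinarith [sq_nonneg (a - 1), mul_le_mul_of_nonneg_left h3 ha0]
      refine h4.trans ?_
      rw [div_mul_eq_mul_div, le_div_iff₀ hy]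
      nlinarith [mul_le_mul_of_nonneg_left hW hC2p.le]
    · have hap : 0 < a := hy.trans h
      rw [Real.log_div hap.ne' hy.ne'] at h'
      have hlp : 0 ≤ Real.log a - Real.log z.im := sub_nonneg.2 (Real.log_le_log hy h.le)
      have hls : Real.log a ≤ 1/2 * Real.log (1 + a ^ 2) := by
        have := Real.log_le_log (show 0 < a ^ 2 by positivity) (show a ^ 2 ≤ 1 + a ^ 2 by linarith)
        rw [Real.log_pow] at this
        push_cast at this
        linarith
      have h4 : a * ‖deriv u z‖ / (1 + a^2) ≤ 3/2/z.im * (Real.log a - Real.log z.im) := by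
        rw [div_le_iff₀ (by positivity)]
        have h5 : 0 ≤ 3/2/z.im * (Real.log a - Real.log z.im) := by positivity
        calc a * ‖deriv u z‖ ≤ a * (3/2/z.im * a * (Real.log a - Real.log z.im)) := by gcongr
          _ = 3/2/z.im * (Real.log a - Real.log z.im) * a ^ 2 := by ring
          _ ≤ _ := by gcongr; linarith
      refine h4.trans ?_
      gcongr
      have : 0 ≤ (2 + C1 * L^2) * s9W z := by positivity
      linarith)
  obtain ⟨E, hE, hG⟩ := hG
  refine ⟨Real.log (3 + C1) + 2 * E + 4, 1000 * R0 + 1, ?_, by linarith, ?_⟩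
  · have := Real.log_nonneg (show 1 ≤ 3 + C1 by linarith)
    positivity
  intro z hy hr
  have hr1 : 1 ≤ ‖z‖ := by linarith
  have hW := s9W_ge_im hy hr1
  have hW1 := s9W_ge_one hy hr1
  have hWl := s9W_ge_log hy hr1
  have h1 := (le_abs_self _).trans (hG z hy hr)
  have h2 := star z hy (by linarith)
  have h0 : ‖1 - deriv u z‖ ≠ 0 := by
    rw [norm_ne_zero_iff, sub_ne_zero]
    exact (hu.2 z ⟨hy, by linarith⟩).1.symm
  have h3 : ‖1 - deriv u z‖ ≤ (3 + C1) * (1 + ‖u z‖ ^ 2) * ((1 + z.im) ^ 2 / z.im ^ 2) := by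
    have : ‖1 - deriv u z‖ ≤ 1 + ‖deriv u z‖ := by simpa using norm_sub_le (1:ℂ) (deriv u z)
    have e1 : 1 + 1 / z.im ^ 2 ≤ (1 + z.im) ^ 2 / z.im ^ 2 := by
      rw [le_div_iff₀ (by positivity)]
      field_simp
      nlinarith
    calc ‖1 - deriv u z‖ ≤ 3 + C1 * ‖u z‖ ^ 2 / z.im ^ 2 := by linarith
      _ ≤ (3 + C1) * (1 + ‖u z‖ ^ 2) * (1 + 1 / z.im ^ 2) := by
        have q : 0 ≤ ‖u z‖ ^ 2 / z.im ^ 2 := by positivity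
        have q1 : 0 ≤ ‖u z‖ ^ 2 := by positivity
        have q2 : 0 ≤ 1 / z.im ^ 2 := by positivity
        have : (1 + ‖u z‖ ^ 2) * (1 + 1 / z.im ^ 2) = 1 + ‖u z‖ ^ 2 + 1 / z.im ^ 2 + ‖u z‖ ^ 2 / z.im ^ 2 := by
          field_simp; ring
        rw [mul_assoc, this, mul_div_assoc]
        nlinarith
      _ ≤ _ := by gcongr
  have h4 := Real.log_le_log (lt_of_le_of_ne (norm_nonneg _) h0.symm) h3
  rw [Real.log_mul (by positivity) (by positivity), Real.log_mul (by positivity) (by positivity),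
    Real.log_div (by positivity) (by positivity), Real.log_pow, Real.log_pow] at h4
  push_cast at h4
  have h5 := Real.log_le_sub_one_of_pos (show 0 < 1 + z.im by linarith)
  have h6 := Real.log_nonneg (show 1 ≤ 3 + C1 by linarith)
  nlinarith

theorem s9W_ball {z w : ℂ} (hy : 0 < z.im) (hw : dist w (z + z.im * I) < 1.9 * z.im) :
    s9W w ≤ 12800 * s9W z := by
  rw [dist_eq_norm] at hw
  have h1 : |(w - (z + z.im * I)).im| < 1.9 * z.im := (Complex.abs_im_le_norm _).trans_lt hw
  simp at h1
  rw [abs_lt] at h1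
  have him : z.im / 10 ≤ w.im := by norm_num at h1 ⊢; linarith [h1.1]
  have h2 : ‖w‖ ≤ ‖z‖ + ‖(z.im : ℂ) * I‖ + ‖w - (z + z.im * I)‖ := by
      calc ‖w‖ = ‖z + (z.im : ℂ) * I + (w - (z + z.im * I))‖ := by congr 1; ring
        _ ≤ _ := (norm_add_le _ _).trans (by gcongr; exact norm_add_le _ _)
  have h3 : ‖(z.im : ℂ) * I‖ = z.im := by simp [abs_of_pos hy]
  have hyr := s9_im_le (z := z)
  have h4 : ‖w‖ ≤ 4 * ‖z‖ := by norm_num at hw; linarith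
  have hzr : 0 < ‖z‖ := hy.trans_le hyr
  unfold s9W
  calc ‖w‖ ^ (7/2 : ℝ) * w.im ^ (-(7/4) : ℝ) ≤ (4 * ‖z‖) ^ (7/2 : ℝ) * (z.im / 10) ^ (-(7/4) : ℝ) := by
        have : w.im ^ (-(7/4) : ℝ) ≤ (z.im / 10) ^ (-(7/4) : ℝ) :=
          Real.rpow_le_rpow_of_nonpos (by positivity) him (by norm_num)
        have hwi : 0 ≤ w.im ^ (-(7/4) : ℝ) := Real.rpow_nonneg (by linarith) _
        gcongr
    _ = (4 ^ (7/2 : ℝ) * 10 ^ (7/4 : ℝ)) * (‖z‖ ^ (7/2 : ℝ) * z.im ^ (-(7/4) : ℝ)) := by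
        rw [Real.mul_rpow (by norm_num) hzr.le, Real.div_rpow hy.le (by norm_num),
          Real.rpow_neg (by norm_num : (0:ℝ) ≤ 10)]
        field_simp
    _ ≤ 12800 * (‖z‖ ^ (7/2 : ℝ) * z.im ^ (-(7/4) : ℝ)) := by
        have e1 : (4:ℝ) ^ (7/2 : ℝ) = 128 := by
          rw [show (4:ℝ) = 2 ^ (2:ℝ) by norm_num, ← Real.rpow_mul (by norm_num)]
          norm_num
        have e2 : (10:ℝ) ^ (7/4 : ℝ) ≤ 100 := by
          calc (10:ℝ) ^ (7/4 : ℝ) ≤ 10 ^ (2:ℝ) := Real.rpow_le_rpow_of_exponent_le (by norm_num) (by norm_num)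
            _ = 100 := by norm_num
        have e3 : (0:ℝ) ≤ 10 ^ (7/4 : ℝ) := by positivity
        gcongr
        rw [e1]; nlinarith

theorem s9_halfplane {u : ℂ → ℂ} {R0 : ℝ} (hR0 : 1 ≤ R0) (hu : s9PP u {z | 0 < z.im ∧ R0 < ‖z‖}) :
    ∃ E R : ℝ, 0 ≤ E ∧ 1 ≤ R ∧ ∀ z : ℂ, 0 < z.im → R ≤ ‖z‖ → |Real.log ‖1 - deriv u z‖| ≤ E * s9W z := by
  obtain ⟨E, R, hE, hR, hg⟩ := s9_growth1 hR0 hu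
  have hA : DifferentiableOn ℂ (fun z => 1 - deriv u z) {z | 0 < z.im ∧ R0 < ‖z‖} :=
    (hu.1.deriv (s9_isOpen R0)).const_sub 1
  have hA0 : ∀ z ∈ {z : ℂ | 0 < z.im ∧ R0 < ‖z‖}, 1 - deriv u z ≠ 0 := by
    intro z hz
    rw [sub_ne_zero]
    exact (hu.2 z hz).1.symm
  set A : ℂ → ℂ := fun z => 1 - deriv u z with hAdef
  have hR' : 1 ≤ R0 + R := by linarith
  have hG := s9_lemmaG (s := fun z => Real.log ‖A z‖) (R1 := 1000 * (R0 + R))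
    (D := 12800 * E + 1) (by linarith) (by positivity) (by
    intro z hy hr v hv
    have hr1 : 1 ≤ ‖z‖ := by linarith
    have hW1 := s9W_ge_one hy hr1
    have hzc : dist z (z + z.im * I) = z.im := by
      simp [dist_eq_norm, abs_of_pos hy]
    have hzB : z ∈ Metric.ball (z + z.im * I) (1.9 * z.im) := by
      rw [Metric.mem_ball, hzc]; norm_num; linarith
    have hsub : ∀ w ∈ Metric.ball (z + z.im * I) (1.9 * z.im), 0 < w.im ∧ 2 * (R0 + R) < ‖w‖ := by
      intro w hw
      have hw' : dist w (z + z.im * I) < 1.98 * z.im := by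
        rw [Metric.mem_ball] at hw
        refine hw.trans ?_
        norm_num; linarith
      have := s9_geom hR' hy hr hw'
      exact ⟨lt_trans (by positivity) this.1, this.2⟩
    have hsub2 : Metric.ball (z + z.im * I) (1.9 * z.im) ⊆ {z : ℂ | 0 < z.im ∧ R0 < ‖z‖} := by
      intro w hw
      have := hsub w hw
      exact ⟨this.1, by linarith [this.2]⟩
    obtain ⟨F, hF1, hF2⟩ := s9_exists_log_ball (g := A) (by positivity) (hA.mono hsub2)
      (fun w hw => hA0 w (hsub2 hw))
    have hre : ∀ w ∈ Metric.ball (z + z.im * I) (1.9 * z.im), (F w).re = Real.log ‖A w‖ := by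
      intro w hw
      rw [← hF2 w hw, Complex.norm_exp, Real.log_exp]
    refine ⟨((deriv A z / A z) * v).re, ?_, ?_⟩
    · have h1 := s9_dir (v := v) (hF1 z hzB)
      have h2 := Complex.reCLM.hasFDerivAt.comp_hasDerivAt (0:ℝ) h1
      refine HasDerivAt.congr_of_eventuallyEq h2 ?_
      have hc : ContinuousAt (fun t : ℝ => z + t * v) 0 := by fun_prop
      have : ∀ᶠ t : ℝ in 𝓝 0, z + t * v ∈ Metric.ball (z + z.im * I) (1.9 * z.im) :=
        hc.eventually_mem (Metric.isOpen_ball.mem_nhds (by simpa using hzB))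
      filter_upwards [this] with t ht
      simp [hre _ ht]
    · set P : ℝ := 12800 * E * s9W z with hP
      have hder : ∀ w ∈ Metric.ball (z + z.im * I) (1.9 * z.im),
        HasDerivAt (fun w => ((P + 1 : ℝ) : ℂ) - F w) (-(deriv A w / A w)) w :=
        fun w hw => (hF1 w hw).const_sub _
      have H := s9_deriv_noncentral (φ := fun w => ((P + 1 : ℝ) : ℂ) - F w)
        (fun w hw => (hder w hw).differentiableAt.differentiableWithinAt) (by
          intro w hw
          simp only [Complex.sub_re, Complex.ofReal_re, hre w hw]
          have h1 := hg w (hsub w hw).1 (by linarith [(hsub w hw).2])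
          have h2 := s9W_ball hy hw
          have h3 : E * s9W w ≤ P := by
            rw [hP]; nlinarith
          have : Real.log ‖A w‖ ≤ E * s9W w := h1
          linarith) hzB
      rw [(hder z hzB).deriv, ← dist_eq_norm, hzc, norm_neg] at H
      simp only [Complex.sub_re, Complex.ofReal_re, hre z hzB] at H
      have hn : |(deriv A z / A z * v).re| ≤ ‖deriv A z / A z‖ := by
        refine (Complex.abs_re_le_norm _).trans ?_
        rw [norm_mul, hv, mul_one]
      refine hn.trans ?_
      have hab := neg_abs_le (Real.log ‖A z‖)
      set l := |Real.log ‖A z‖| with hl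
      have hl0 : 0 ≤ l := abs_nonneg _
      set b := ‖deriv A z / A z‖ with hb
      have hb0 : 0 ≤ b := norm_nonneg _
      have hP0 : 0 ≤ P := by positivity
      have e1 : b * (2.61 * z.im) ≤ 3.8 * (P + 1 + l) := by
        have h5 : 2 * (1.9 * z.im) * (P + 1 - Real.log ‖A z‖) ≤ 2 * (1.9 * z.im) * (P + 1 + l) := by
          gcongr; linarith
        have : (b * (2.61 * z.im)) * z.im ≤ (3.8 * (P + 1 + l)) * z.im := by
          norm_num at H h5 ⊢
          linarith
        exact le_of_mul_le_mul_right this hy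
      rw [div_mul_eq_mul_div, le_div_iff₀ hy]
      have : P + 1 + l ≤ (12800 * E + 1) * s9W z + l := by rw [hP]; linarith
      norm_num at e1 ⊢
      linarith)
  obtain ⟨E', hE', hG⟩ := hG
  exact ⟨E', 1000 * (R0 + R) + 1, hE', by linarith, hG⟩


/-! ### Part 8: entire functions with the half plane bound are affine -/

theorem s9_affine_deriv {h : ℂ → ℂ} (hh : Differentiable ℂ h) {C R : ℝ} (hC : 0 ≤ C) (hR : 1 ≤ R)
    (hb : ∀ z : ℂ, z.im ≠ 0 → R ≤ ‖z‖ → |(h z).re| ≤ C * (‖z‖ ^ (7/2 : ℝ) * |z.im| ^ (-(7/4) : ℝ)))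
    {z : ℂ} (hy : z.im ≠ 0) (hr : 2 * R ≤ ‖z‖) :
    ‖deriv h z‖ ≤ 4 * (128 * C + 1) * (‖z‖ ^ (7/2 : ℝ) * |z.im| ^ (-(11/4) : ℝ)) := by
  have hyp : 0 < |z.im| := abs_pos.2 hy
  have hyr : |z.im| ≤ ‖z‖ := Complex.abs_im_le_norm z
  have hzr : 0 < ‖z‖ := by linarith
  set W := ‖z‖ ^ (7/2 : ℝ) * |z.im| ^ (-(7/4) : ℝ) with hW
  have hW0 : 0 < W := by positivity
  have hW1 : 1 ≤ W := by
    calc (1:ℝ) ≤ ‖z‖ ^ (7/4 : ℝ) := Real.one_le_rpow (by linarith) (by norm_num)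
      _ = ‖z‖ ^ (7/2 : ℝ) * ‖z‖ ^ (-(7/4) : ℝ) := by rw [← Real.rpow_add hzr]; norm_num
      _ ≤ W := by
        rw [hW]
        have := Real.rpow_le_rpow_of_nonpos hyp hyr (show (-(7/4) : ℝ) ≤ 0 by norm_num)
        gcongr
  have hball : ∀ w ∈ Metric.ball z (|z.im| / 2), |(h w).re| ≤ 64 * C * W := by
    intro w hw
    rw [Metric.mem_ball, dist_eq_norm] at hw
    have h1 : |(w - z).im| < |z.im| / 2 := (Complex.abs_im_le_norm _).trans_lt hw
    rw [Complex.sub_im] at h1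
    have h2 : |z.im| / 2 ≤ |w.im| := by
      have := abs_sub_abs_le_abs_sub z.im w.im
      rw [abs_sub_comm] at this
      linarith
    have h3 := norm_sub_norm_le z w
    rw [norm_sub_rev] at h3
    have h4 := norm_sub_norm_le w z
    have hwp : 0 < |w.im| := by linarith
    refine (hb w (abs_pos.1 hwp) (by linarith)).trans ?_
    have h5 : ‖w‖ ≤ 2 * ‖z‖ := by linarith
    have h6 : |w.im| ^ (-(7/4) : ℝ) ≤ (|z.im| / 2) ^ (-(7/4) : ℝ) :=
      Real.rpow_le_rpow_of_nonpos (by positivity) h2 (by norm_num)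
    have h7 : ‖w‖ ^ (7/2 : ℝ) * |w.im| ^ (-(7/4) : ℝ) ≤ 64 * W := by
      calc _ ≤ (2 * ‖z‖) ^ (7/2 : ℝ) * (|z.im| / 2) ^ (-(7/4) : ℝ) := by gcongr
        _ = (2 ^ (7/2 : ℝ) * 2 ^ (7/4 : ℝ)) * W := by
          rw [hW, Real.mul_rpow (by norm_num) hzr.le, Real.div_rpow hyp.le (by norm_num),
            Real.rpow_neg (by norm_num : (0:ℝ) ≤ 2)]
          field_simp
        _ ≤ 64 * W := by
          gcongr
          rw [← Real.rpow_add (by norm_num)]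
          calc (2:ℝ) ^ (7/2 + 7/4 : ℝ) ≤ 2 ^ (6:ℝ) :=
                Real.rpow_le_rpow_of_exponent_le (by norm_num) (by norm_num)
            _ = 64 := by norm_num
    nlinarith
  have H := s9_deriv_center (φ := fun w => h w + ((64 * C * W + 1 : ℝ) : ℂ)) (c := z)
    (ρ := |z.im| / 2) (by positivity) (hh.add_const _).differentiableOn (by
      intro w hw
      have := neg_le_of_abs_le (hball w hw)
      simp only [Complex.add_re, Complex.ofReal_re]
      linarith)
  rw [deriv_add_const] at H
  refine H.trans ?_
  have h1 := le_of_abs_le (hball z (Metric.mem_ball_self (by positivity)))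
  simp only [Complex.add_re, Complex.ofReal_re]
  have e : |z.im| ^ (-(11/4) : ℝ) = |z.im| ^ (-(7/4) : ℝ) / |z.im| := by
    rw [← Real.rpow_sub_one hyp.ne']; norm_num
  rw [e, ← mul_div_assoc, ← hW, ← mul_div_assoc, div_le_div_iff₀ (by positivity) hyp]
  nlinarith [mul_pos hyp hW0, mul_nonneg hC hW0.le]

theorem s9_affine {h : ℂ → ℂ} (hh : Differentiable ℂ h) {C R : ℝ} (hC : 0 ≤ C) (hR : 1 ≤ R)
    (hb : ∀ z : ℂ, z.im ≠ 0 → R ≤ ‖z‖ → |(h z).re| ≤ C * (‖z‖ ^ (7/2 : ℝ) * |z.im| ^ (-(7/4) : ℝ))) :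
    ∃ a b : ℂ, ∀ z, h z = a * z + b := by
  have hh' : Differentiable ℂ (deriv h) := fun z =>
    ((hh.analyticAt z).deriv).differentiableAt
  set C2 := 4 * (128 * C + 1) with hC2
  have hC2p : 0 < C2 := by positivity
  have hgrow : ∀ r : ℝ, 2 * R ≤ r → ∀ z : ℂ, ‖z‖ ≤ r / 2 → ‖deriv h z‖ ≤ 64 * C2 * r ^ (3/4 : ℝ) := by
    intro r hr z hz
    have hrp : 0 < r := by linarith
    set g : ℂ → ℂ := fun w => deriv h w * (w ^ 2 - (r:ℂ) ^ 2) ^ 3 with hg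
    have hgd : Differentiable ℂ g := by
      intro w
      exact (hh' w).mul (by fun_prop)
    have hfr : ∀ w ∈ frontier (Metric.ball (0:ℂ) r), ‖g w‖ ≤ 8 * C2 * r ^ (27/4 : ℝ) := by
      intro w hw
      rw [frontier_ball _ hrp.ne', mem_sphere_zero_iff_norm] at hw
      have e1 : ‖w ^ 2 - (r:ℂ) ^ 2‖ = 2 * r * |w.im| := by
        have : w ^ 2 - (r:ℂ) ^ 2 = w * (2 * w.im * I) := by
          have h1 : (r:ℂ) ^ 2 = w * (starRingEnd ℂ) w := by
            rw [Complex.mul_conj, Complex.normSq_eq_norm_sq, hw]; push_cast; ring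
          have h2 := Complex.sub_conj w
          push_cast at h2
          rw [h1, ← h2]
          ring
        rw [this]
        simp only [norm_mul, hw, Complex.norm_I, Complex.norm_real, Real.norm_eq_abs,
          RCLike.norm_ofNat]
        ring
      rw [hg]
      simp only [norm_mul, norm_pow, e1]
      by_cases hy : w.im = 0
      · simp only [hy]
        simp
        positivity
      · have hyp : 0 < |w.im| := abs_pos.2 hy
        have h1 := s9_affine_deriv hh hC hR hb hy (by linarith)
        rw [hw, ← hC2] at h1
        have hyr : |w.im| ≤ r := hw ▸ Complex.abs_im_le_norm w
        calc _ ≤ C2 * (r ^ (7/2 : ℝ) * |w.im| ^ (-(11/4) : ℝ)) * (2 * r * |w.im|) ^ 3 := by gcongr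
          _ = 8 * C2 * (r ^ (7/2 : ℝ) * r ^ (3:ℝ)) * (|w.im| ^ (-(11/4) : ℝ) * |w.im| ^ (3:ℝ)) := by
            rw [show (3:ℝ) = ((3:ℕ):ℝ) by norm_num, Real.rpow_natCast, Real.rpow_natCast]; push_cast; ring
          _ = 8 * C2 * r ^ (13/2 : ℝ) * |w.im| ^ (1/4 : ℝ) := by
            rw [← Real.rpow_add hrp, ← Real.rpow_add hyp]; norm_num
          _ ≤ 8 * C2 * r ^ (13/2 : ℝ) * r ^ (1/4 : ℝ) := by gcongr
          _ = _ := by rw [mul_assoc, ← Real.rpow_add hrp]; norm_num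
    have hmax := Complex.norm_le_of_forall_mem_frontier_norm_le Metric.isBounded_ball
      hgd.diffContOnCl hfr (z := z) (by
        rw [closure_ball _ hrp.ne', mem_closedBall_zero_iff]; linarith)
    have hlow : r ^ 2 / 2 ≤ ‖z ^ 2 - (r:ℂ) ^ 2‖ := by
      have h1 := norm_sub_norm_le ((r:ℂ) ^ 2) (z ^ 2)
      rw [norm_sub_rev, norm_pow, norm_pow, Complex.norm_real, Real.norm_eq_abs, sq_abs] at h1
      nlinarith [norm_nonneg z]
    have h2 : ‖deriv h z‖ * (r ^ 2 / 2) ^ 3 ≤ 8 * C2 * r ^ (27/4 : ℝ) := by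
      refine le_trans ?_ hmax
      rw [hg]
      simp only [norm_mul, norm_pow]
      gcongr
    have e2 : r ^ (27/4 : ℝ) = r ^ 6 * r ^ (3/4 : ℝ) := by
      rw [← Real.rpow_natCast, ← Real.rpow_add hrp]; norm_num
    rw [e2] at h2
    have : ‖deriv h z‖ * r ^ 6 ≤ (64 * C2 * r ^ (3/4 : ℝ)) * r ^ 6 := by nlinarith
    exact le_of_mul_le_mul_right this (by positivity)
  have hdd : ∀ c, deriv (deriv h) c = 0 := by
    intro c
    rw [← norm_eq_zero]
    refine le_antisymm ?_ (norm_nonneg _)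
    have ht : Tendsto (fun r : ℝ => 256 * C2 * r ^ (-(1/4) : ℝ)) atTop (𝓝 (256 * C2 * 0)) :=
      (tendsto_rpow_neg_atTop (by norm_num)).const_mul _
    rw [mul_zero] at ht
    refine ge_of_tendsto ht ?_
    filter_upwards [eventually_ge_atTop (2 * R), eventually_ge_atTop (4 * ‖c‖)] with r h1 h2
    have hrp : 0 < r := by linarith
    have := Complex.norm_deriv_le_of_forall_mem_sphere_norm_le (f := deriv h) (c := c) (R := r / 4)
      (C := 64 * C2 * r ^ (3/4 : ℝ)) (by positivity) hh'.diffContOnCl (by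
        intro w hw
        refine hgrow r h1 w ?_
        rw [mem_sphere_iff_norm] at hw
        have := norm_sub_norm_le w c
        linarith)
    refine this.trans (le_of_eq ?_)
    have e : r ^ (-(1/4) : ℝ) = r ^ (3/4 : ℝ) / r := by
      rw [← Real.rpow_sub_one hrp.ne']; norm_num
    rw [e]
    field_simp
    norm_num
  have hconst : ∀ z, deriv h z = deriv h 0 := fun z => is_const_of_deriv_eq_zero hh' hdd z 0
  refine ⟨deriv h 0, h 0, ?_⟩
  have hk : Differentiable ℂ (fun z => h z - deriv h 0 * z) := by
    intro z; exact (hh z).sub (by fun_prop)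
  intro z
  have := is_const_of_deriv_eq_zero hk (by
    intro w
    have h1 : HasDerivAt (fun z => h z - deriv h 0 * z) (deriv h w - deriv h 0 * 1) w :=
      (hh w).hasDerivAt.sub ((hasDerivAt_id w).const_mul _)
    rw [h1.deriv, hconst w]; ring) z 0
  simp at this
  linear_combination this


/-! ### Part 9: meromorphic preliminaries -/

theorem s9_tend_conj (z : ℂ) :
    Tendsto (starRingEnd ℂ) (𝓝[≠] z) (𝓝[≠] ((starRingEnd ℂ) z)) := by
  refine tendsto_nhdsWithin_iff.2 ⟨?_, ?_⟩
  · exact (Complex.continuous_conj.tendsto z).mono_left nhdsWithin_le_nhds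
  · filter_upwards [self_mem_nhdsWithin] with w hw h
    exact hw ((starRingEnd ℂ).injective h)

theorem s9_mtilde_mtilde (f : ℂ → ℂ) : mtilde (mtilde f) = f := by
  funext z; simp [mtilde]

theorem s9_mtilde_deriv (f : ℂ → ℂ) : deriv (mtilde f) = mtilde (deriv f) :=
  deriv_conj_conj (f := f)

theorem s9_mtilde_iteratedDeriv (f : ℂ → ℂ) (m : ℕ) :
    iteratedDeriv m (mtilde f) = mtilde (iteratedDeriv m f) := by
  induction m with
  | zero => simp
  | succ m ih => rw [iteratedDeriv_succ, iteratedDeriv_succ, ih, s9_mtilde_deriv]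

theorem s9_mtilde_analyticAt {g : ℂ → ℂ} {z : ℂ} (hg : AnalyticAt ℂ g ((starRingEnd ℂ) z)) :
    AnalyticAt ℂ (mtilde g) z := by
  rw [Complex.analyticAt_iff_eventually_differentiableAt] at hg ⊢
  have := (Complex.continuous_conj.tendsto z).eventually hg
  filter_upwards [this] with w hw
  have := hw.conj_conj
  rw [Complex.conj_conj] at this
  exact this

theorem s9_mtilde_meromorphicAt {g : ℂ → ℂ} {z : ℂ} (hg : MeromorphicAt g ((starRingEnd ℂ) z)) :
    MeromorphicAt (mtilde g) z := by
  obtain ⟨n, hn⟩ := hg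
  refine ⟨n, ?_⟩
  have := s9_mtilde_analyticAt hn
  have e : (fun w => (w - z) ^ n • mtilde g w) =
      mtilde (fun w => (w - (starRingEnd ℂ) z) ^ n • g w) := by
    funext w
    simp [mtilde]
  rw [e]
  exact this

theorem s9_mtilde_order {g : ℂ → ℂ} {z : ℂ} (hg : MeromorphicAt g ((starRingEnd ℂ) z)) :
    meromorphicOrderAt (mtilde g) z = meromorphicOrderAt g ((starRingEnd ℂ) z) := by
  have hg' := s9_mtilde_meromorphicAt hg
  rcases h : meromorphicOrderAt g ((starRingEnd ℂ) z) with _ | n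
  · change _ = (⊤ : WithTop ℤ) at h ⊢
    rw [meromorphicOrderAt_eq_top_iff] at h ⊢
    filter_upwards [(s9_tend_conj z).eventually h] with w hw
    simp [mtilde, hw]
  · change _ = ((n : ℤ) : WithTop ℤ) at h ⊢
    rw [meromorphicOrderAt_eq_int_iff hg] at h
    rw [meromorphicOrderAt_eq_int_iff hg']
    obtain ⟨k, hk, hk0, hkn⟩ := h
    refine ⟨mtilde k, s9_mtilde_analyticAt hk, by simpa [mtilde] using hk0, ?_⟩
    filter_upwards [(s9_tend_conj z).eventually hkn] with w hw
    simp [mtilde, hw]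

/-- The function `φ φ'' / φ' ^ 2`. -/
noncomputable def s9B (φ : ℂ → ℂ) : ℂ → ℂ := fun z => φ z * deriv (deriv φ) z / deriv φ z ^ 2

theorem s9_mtilde_B (φ : ℂ → ℂ) : s9B (mtilde φ) = mtilde (s9B φ) := by
  funext z
  simp [s9B, s9_mtilde_deriv, mtilde]

/-- The standing assumptions on `φ = f^(m)`. -/
def s9Good (φ : ℂ → ℂ) : Prop :=
  (∀ z, MeromorphicAt φ z) ∧ (∀ z, meromorphicOrderAt φ z ≠ ⊤) ∧
  (∀ z, meromorphicOrderAt (deriv φ) z ≠ ⊤) ∧ (∀ z, meromorphicOrderAt (deriv (deriv φ)) z ≠ ⊤) ∧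
  {z : ℂ | z.im ≠ 0 ∧ (0 < meromorphicOrderAt φ z ∨ 0 < meromorphicOrderAt (deriv φ) z ∨
    0 < meromorphicOrderAt (deriv (deriv φ)) z)}.Finite

theorem s9Good.tilde {φ : ℂ → ℂ} (h : s9Good φ) : s9Good (mtilde φ) := by
  obtain ⟨h1, h2, h3, h4, h5⟩ := h
  have o1 : ∀ z, meromorphicOrderAt (mtilde φ) z = meromorphicOrderAt φ ((starRingEnd ℂ) z) :=
    fun z => s9_mtilde_order (h1 _)
  have o2 : ∀ z, meromorphicOrderAt (deriv (mtilde φ)) z =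
      meromorphicOrderAt (deriv φ) ((starRingEnd ℂ) z) := by
    intro z; rw [s9_mtilde_deriv]; exact s9_mtilde_order (h1 _).deriv
  have o3 : ∀ z, meromorphicOrderAt (deriv (deriv (mtilde φ))) z =
      meromorphicOrderAt (deriv (deriv φ)) ((starRingEnd ℂ) z) := by
    intro z; rw [s9_mtilde_deriv, s9_mtilde_deriv]; exact s9_mtilde_order (h1 _).deriv.deriv
  refine ⟨fun z => s9_mtilde_meromorphicAt (h1 _), fun z => by rw [o1]; exact h2 _,
    fun z => by rw [o2]; exact h3 _, fun z => by rw [o3]; exact h4 _, ?_⟩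
  have := h5.preimage ((starRingEnd ℂ).injective.injOn)
  refine this.subset ?_
  intro z hz
  simp only [Set.mem_ofPred_eq, o1, o2, o3] at hz
  simpa using hz

theorem s9_B_mero {φ : ℂ → ℂ} (h : s9Good φ) (z : ℂ) : MeromorphicAt (s9B φ) z :=
  ((h.1 z).mul (h.1 z).deriv.deriv).div ((h.1 z).deriv.pow 2)

theorem s9_B_ne {φ : ℂ → ℂ} (h : s9Good φ) (z : ℂ) : ∀ᶠ w in 𝓝[≠] z, s9B φ w ≠ 0 := by
  have h1 := (meromorphicOrderAt_ne_top_iff_eventually_ne_zero (h.1 z)).1 (h.2.1 z)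
  have h2 := (meromorphicOrderAt_ne_top_iff_eventually_ne_zero (h.1 z).deriv).1 (h.2.2.1 z)
  have h3 := (meromorphicOrderAt_ne_top_iff_eventually_ne_zero (h.1 z).deriv.deriv).1 (h.2.2.2.1 z)
  filter_upwards [h1, h2, h3] with w w1 w2 w3
  simp [s9B, w1, w2, w3]

theorem s9_hasDeriv {φ : ℂ → ℂ} (h : s9Good φ) (z : ℂ) :
    ∀ᶠ w in 𝓝[≠] z, HasDerivAt (fun w => φ w / deriv φ w) (1 - s9B φ w) w := by
  have h2 := (meromorphicOrderAt_ne_top_iff_eventually_ne_zero (h.1 z).deriv).1 (h.2.2.1 z)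
  filter_upwards [h2, (h.1 z).eventually_analyticAt] with w w2 wa
  refine (wa.differentiableAt.hasDerivAt.div wa.deriv.differentiableAt.hasDerivAt w2).congr_deriv ?_
  simp only [s9B]
  field_simp

theorem s9_order_deriv_nonneg {φ : ℂ → ℂ} {z : ℂ} (h : MeromorphicAt φ z)
    (h0 : 0 ≤ meromorphicOrderAt φ z) : ∃ g, AnalyticAt ℂ g z ∧ φ =ᶠ[𝓝[≠] z] g := by
  have := toMeromorphicNFAt φ z
  refine ⟨toMeromorphicNFAt φ z, ?_, h.eq_nhdsNE_toMeromorphicNFAt⟩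
  exact (h.meromorphicOrderAt_nonneg_iff_analyticAt_toMeromorphicNFAt).1 h0

theorem s9_nhdsNE_deriv {f g : ℂ → ℂ} {z : ℂ} (h : f =ᶠ[𝓝[≠] z] g) : deriv f =ᶠ[𝓝[≠] z] deriv g :=
  h.nhdsNE_deriv

/-- If all three orders are at most zero, either `φ` has a pole or all three functions
are analytic and nonzero after removing singularities. -/
theorem s9_zero_case {φ : ℂ → ℂ} {z : ℂ} (h : MeromorphicAt φ z)
    (o0 : meromorphicOrderAt φ z = 0) (o1 : meromorphicOrderAt (deriv φ) z ≤ 0)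
    (o2 : meromorphicOrderAt (deriv (deriv φ)) z ≤ 0) :
    ∃ g, AnalyticAt ℂ g z ∧ φ =ᶠ[𝓝[≠] z] g ∧ g z ≠ 0 ∧ deriv g z ≠ 0 ∧ deriv (deriv g) z ≠ 0 := by
  obtain ⟨g, hg, hfg⟩ := s9_order_deriv_nonneg h o0.ge
  have key : ∀ k : ℂ → ℂ, AnalyticAt ℂ k z → meromorphicOrderAt k z ≤ 0 → k z ≠ 0 := by
    intro k hk hle
    exact (hk.meromorphicNFAt.meromorphicOrderAt_eq_zero_iff).1 (le_antisymm hle hk.meromorphicOrderAt_nonneg)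
  refine ⟨g, hg, hfg, key g hg ?_, key _ hg.deriv ?_, key _ hg.deriv.deriv ?_⟩
  · rw [← meromorphicOrderAt_congr hfg]; exact o0.le
  · rw [← meromorphicOrderAt_congr hfg.nhdsNE_deriv]; exact o1
  · rw [← meromorphicOrderAt_congr hfg.nhdsNE_deriv.nhdsNE_deriv]; exact o2

theorem s9_B_order {φ : ℂ → ℂ} {z : ℂ} (h : MeromorphicAt φ z)
    (o0 : meromorphicOrderAt φ z ≤ 0) (o1 : meromorphicOrderAt (deriv φ) z ≤ 0)
    (o2 : meromorphicOrderAt (deriv (deriv φ)) z ≤ 0) : meromorphicOrderAt (s9B φ) z = 0 := by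
  rcases o0.lt_or_eq with hlt | heq
  · obtain ⟨n, hn⟩ := WithTop.ne_top_iff_exists.1 (ne_top_of_lt hlt)
    rw [← hn] at hlt
    have hn0 : n < 0 := by exact_mod_cast hlt
    have p1 := meromorphicOrderAt_deriv_eq_sub_one (n := n) (by exact_mod_cast hn0.ne) hn.symm
    have p2 := meromorphicOrderAt_deriv_eq_sub_one (n := n - 1) (by exact_mod_cast (show n - 1 ≠ 0 by omega)) p1
    have e : s9B φ = (φ * deriv (deriv φ)) / (deriv φ * deriv φ) := by
      funext w; simp [s9B, sq]
    rw [e, meromorphicOrderAt_div (h.mul h.deriv.deriv) (h.deriv.mul h.deriv),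
      meromorphicOrderAt_mul h h.deriv.deriv, meromorphicOrderAt_mul h.deriv h.deriv, p1, p2, ← hn]
    norm_cast
    ring
  · obtain ⟨g, hg, hfg, g0, g1, g2⟩ := s9_zero_case h heq o1 o2
    have hB : s9B φ =ᶠ[𝓝[≠] z] s9B g := by
      filter_upwards [hfg, hfg.nhdsNE_deriv, hfg.nhdsNE_deriv.nhdsNE_deriv] with w w0 w1 w2
      simp [s9B, w0, w1, w2]
    rw [meromorphicOrderAt_congr hB]
    have ha : AnalyticAt ℂ (s9B g) z := (hg.mul hg.deriv.deriv).div (hg.deriv.pow 2) (by simpa using g1)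
    rw [ha.meromorphicNFAt.meromorphicOrderAt_eq_zero_iff]
    simp [s9B, g0, g1, g2]

theorem s9_local {φ : ℂ → ℂ} {z : ℂ} (h : MeromorphicAt φ z)
    (o0 : meromorphicOrderAt φ z ≤ 0) (o1 : meromorphicOrderAt (deriv φ) z ≤ 0)
    (o2 : meromorphicOrderAt (deriv (deriv φ)) z ≤ 0) :
    ∃ v, AnalyticAt ℂ v z ∧ (fun w => φ w / deriv φ w) =ᶠ[𝓝[≠] z] v ∧ deriv v z ≠ 1 ∧
      (v z = 0 → (deriv v z).im = 0 ∧ -1 ≤ (deriv v z).re ∧ (deriv v z).re ≤ 0) := by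
  rcases o0.lt_or_eq with hlt | heq
  · obtain ⟨n, hn⟩ := WithTop.ne_top_iff_exists.1 (ne_top_of_lt hlt)
    rw [← hn] at hlt
    have hn0 : n < 0 := by exact_mod_cast hlt
    obtain ⟨g, hg, hg0, hfg⟩ := (meromorphicOrderAt_eq_int_iff h).1 hn.symm
    have hnc : (n : ℂ) ≠ 0 := by exact_mod_cast hn0.ne
    have hden : (n : ℂ) * g z + (z - z) * deriv g z ≠ 0 := by simp [hnc, hg0]
    have hda : AnalyticAt ℂ (fun w => (n : ℂ) * g w + (w - z) * deriv g w) z := by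
      have := hg.deriv
      fun_prop
    have hq : AnalyticAt ℂ (fun w => g w / ((n : ℂ) * g w + (w - z) * deriv g w)) z := hg.div hda hden
    have hv : AnalyticAt ℂ (fun w => (w - z) * (g w / ((n : ℂ) * g w + (w - z) * deriv g w))) z := by
      fun_prop
    have hderiv : deriv (fun w => (w - z) * (g w / ((n : ℂ) * g w + (w - z) * deriv g w))) z = 1 / n := by
      have h1 : HasDerivAt (fun w : ℂ => w - z) 1 z := (hasDerivAt_id z).sub_const z
      have h2 := h1.mul hq.differentiableAt.hasDerivAt
      refine h2.deriv.trans ?_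
      simp
      field_simp
    refine ⟨_, hv, ?_, ?_, ?_⟩
    · have hfg' : φ =ᶠ[𝓝[≠] z] fun w => (w - z) ^ n * g w := hfg
      have hev : ∀ᶠ w in 𝓝[≠] z, AnalyticAt ℂ g w := nhdsWithin_le_nhds hg.eventually_analyticAt
      filter_upwards [hfg', hfg'.nhdsNE_deriv, self_mem_nhdsWithin, hev] with w w0 w1 wne wa
      have wne' : w - z ≠ 0 := sub_ne_zero.2 wne
      have hd : deriv (fun w => (w - z) ^ n * g w) w =
          (w - z) ^ (n - 1) * (n * g w + (w - z) * deriv g w) := by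
        have h1 : HasDerivAt (fun w : ℂ => w - z) 1 w := (hasDerivAt_id w).sub_const z
        have h2 : HasDerivAt (fun w : ℂ => (w - z) ^ n) ((n : ℂ) * (w - z) ^ (n - 1) * 1) w :=
          HasDerivAt.comp w (h := fun w : ℂ => w - z) (h₂ := fun w : ℂ => w ^ n)
            (hasDerivAt_zpow n (w - z) (Or.inl wne')) h1
        have h3 := h2.mul wa.differentiableAt.hasDerivAt
        refine h3.deriv.trans ?_
        have : (w - z) ^ n = (w - z) ^ (n - 1) * (w - z) := by
          rw [← zpow_add_one₀ wne']; simp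
        rw [this]; ring
      rw [w0, w1, hd]
      have : (w - z) ^ n = (w - z) ^ (n - 1) * (w - z) := by
          rw [← zpow_add_one₀ wne']; simp
      rw [this]
      have hz : (w - z) ^ (n - 1) ≠ 0 := zpow_ne_zero _ wne'
      rw [mul_assoc, mul_div_mul_left _ _ hz, mul_div_assoc]
    · rw [hderiv]
      intro hh
      rw [div_eq_iff hnc, one_mul] at hh
      have : (1:ℤ) = n := by exact_mod_cast hh
      omega
    · intro _
      rw [hderiv]
      have e : (1 / (n:ℂ)) = ((1 / (n:ℝ) : ℝ) : ℂ) := by push_cast; rfl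
      rw [e, Complex.ofReal_im, Complex.ofReal_re]
      have hnr : (n:ℝ) ≤ -1 := by exact_mod_cast (show n ≤ -1 by omega)
      refine ⟨rfl, ?_, ?_⟩
      · rw [le_div_iff_of_neg (by linarith)]; linarith
      · exact div_nonpos_of_nonneg_of_nonpos zero_le_one (by linarith)
  · obtain ⟨g, hg, hfg, g0, g1, g2⟩ := s9_zero_case h heq o1 o2
    have hv : AnalyticAt ℂ (fun w => g w / deriv g w) z := hg.div hg.deriv g1
    refine ⟨_, hv, ?_, ?_, ?_⟩
    · filter_upwards [hfg, hfg.nhdsNE_deriv] with w w0 w1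
      rw [w0, w1]
    · have := (hg.differentiableAt.hasDerivAt.div hg.deriv.differentiableAt.hasDerivAt g1).deriv
      intro hh
      have h2 := this.symm.trans hh
      rw [div_eq_iff (by simpa using g1)] at h2
      have : g z * deriv (deriv g) z = 0 := by linear_combination -h2
      simp [g0, g2] at this
    · intro hh
      simp [g0, g1] at hh

theorem s9_B_bound {φ : ℂ → ℂ} (h : s9Good φ) : ∃ E R : ℝ, 0 ≤ E ∧ 1 ≤ R ∧
    ∀ z : ℂ, 0 < z.im → R < ‖z‖ → ∀ᶠ w in 𝓝[≠] z, |Real.log ‖s9B φ w‖| ≤ E * s9W w := by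
  obtain ⟨Rs, hRs⟩ := h.2.2.2.2.isBounded.exists_norm_le
  set R0 := max 1 Rs with hR0
  have hmer : MeromorphicOn (fun w => φ w / deriv φ w) Set.univ := fun z _ => (h.1 z).div (h.1 z).deriv
  set u := toMeromorphicNFOn (fun w => φ w / deriv φ w) Set.univ with hu
  have huNF : ∀ z, MeromorphicNFAt u z := fun z => meromorphicNFOn_toMeromorphicNFOn _ _ (Set.mem_univ z)
  have hue : ∀ z, u =ᶠ[𝓝[≠] z] (fun w => φ w / deriv φ w) := fun z =>
    hmer.toMeromorphicNFOn_eq_self_on_nhdsNE (Set.mem_univ z)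
  have hPP : s9PP u {z | 0 < z.im ∧ R0 < ‖z‖} := by
    have key : ∀ z : ℂ, 0 < z.im → R0 < ‖z‖ → ∃ v, AnalyticAt ℂ v z ∧ u =ᶠ[𝓝 z] v ∧ deriv v z ≠ 1 ∧
        (v z = 0 → (deriv v z).im = 0 ∧ -1 ≤ (deriv v z).re ∧ (deriv v z).re ≤ 0) := by
      intro z hz hzr
      have hns : ¬ (0 < meromorphicOrderAt φ z ∨ 0 < meromorphicOrderAt (deriv φ) z ∨
          0 < meromorphicOrderAt (deriv (deriv φ)) z) := by
        intro hc
        have := hRs z ⟨hz.ne', hc⟩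
        have := le_max_right 1 Rs
        linarith
      push Not at hns
      obtain ⟨v, hv1, hv2, hv3, hv4⟩ := s9_local (h.1 z) hns.1 hns.2.1 hns.2.2
      refine ⟨v, hv1, ?_, hv3, hv4⟩
      exact ((huNF z).eventuallyEq_nhdsNE_iff_eventuallyEq_nhds hv1.meromorphicNFAt).1 ((hue z).trans hv2)
    refine ⟨?_, ?_⟩
    · rintro z ⟨hz, hzr⟩
      obtain ⟨v, hv1, hv2, -⟩ := key z hz hzr
      exact (hv1.differentiableAt.congr_of_eventuallyEq hv2).differentiableWithinAt
    · rintro z ⟨hz, hzr⟩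
      obtain ⟨v, hv1, hv2, hv3, hv4⟩ := key z hz hzr
      rw [hv2.deriv_eq, hv2.eq_of_nhds]
      exact ⟨hv3, hv4⟩
  obtain ⟨E, R, hE, hR, hb⟩ := s9_halfplane (le_max_left 1 Rs) hPP
  refine ⟨E, R, hE, hR, ?_⟩
  intro z hz hzr
  have hopen : ∀ᶠ w in 𝓝[≠] z, w ∈ {w : ℂ | 0 < w.im ∧ R < ‖w‖} :=
    nhdsWithin_le_nhds ((s9_isOpen R).mem_nhds ⟨hz, hzr⟩)
  filter_upwards [hopen, (hue z).nhdsNE_deriv, s9_hasDeriv h z] with w w1 w2 w3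
  have := hb w w1.1 w1.2.le
  rw [w2, w3.deriv] at this
  simpa using this


/-! ### Part 10: the factorisation of the quotient -/

theorem s9_isRat (S : Finset ℂ) (d : ℂ → ℤ) (c : ℂ) :
    IsRatFn (fun z => c * ∏ s ∈ S, (z - s) ^ d s) := by
  refine ⟨Polynomial.C c * ∏ s ∈ S, (Polynomial.X - Polynomial.C s) ^ (d s).toNat,
    ∏ s ∈ S, (Polynomial.X - Polynomial.C s) ^ (-(d s)).toNat, ?_, ?_⟩
  · rw [Finset.prod_ne_zero_iff]
    intro s _
    exact pow_ne_zero _ (Polynomial.X_sub_C_ne_zero s)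
  · intro z
    refine Eventually.of_forall fun w => ?_
    simp only [Polynomial.eval_mul, Polynomial.eval_C, Polynomial.eval_prod, Polynomial.eval_pow,
      Polynomial.eval_sub, Polynomial.eval_X]
    rw [mul_div_assoc, ← Finset.prod_div_distrib]
    congr 1
    refine Finset.prod_congr rfl fun s _ => ?_
    rcases le_total 0 (d s) with h | h
    · obtain ⟨n, hn⟩ := Int.eq_ofNat_of_zero_le h
      rw [hn]; simp
    · obtain ⟨n, hn⟩ := Int.eq_ofNat_of_zero_le (neg_nonneg.2 h)
      have hn' : d s = -(n:ℤ) := by omega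
      rw [hn']; simp

theorem s9_rat_bound (S : Finset ℂ) (d : ℂ → ℤ) : ∃ D R : ℝ, 0 ≤ D ∧ 1 ≤ R ∧
    (∀ s ∈ S, ‖s‖ < R) ∧
    ∀ z : ℂ, R ≤ ‖z‖ → |Real.log ‖∏ s ∈ S, (z - s) ^ d s‖| ≤ D * ‖z‖ ^ (1/2 : ℝ) := by
  obtain ⟨Rs, hRs⟩ := S.finite_toSet.isBounded.exists_norm_le
  have m1 := le_max_left 1 Rs
  have m2 := le_max_right 1 Rs
  refine ⟨∑ s ∈ S, |(d s : ℝ)| * 4, 2 * max 1 Rs, by positivity, by linarith, ?_, ?_⟩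
  · intro s hs
    have := hRs s hs
    linarith
  intro z hz
  have hrp : 0 < ‖z‖ := by linarith
  have hs : ∀ s ∈ S, ‖z‖ / 2 ≤ ‖z - s‖ ∧ ‖z - s‖ ≤ 2 * ‖z‖ := by
    intro s hs
    have h1 := hRs s hs
    have h2 := norm_sub_norm_le z s
    have h3 := norm_sub_le z s
    exact ⟨by linarith, by linarith⟩
  rw [norm_prod, Real.log_prod (by
    intro s hs'
    have h0 : 0 < ‖z - s‖ := by linarith [(hs s hs').1]
    rw [norm_zpow]
    exact zpow_ne_zero _ h0.ne')]
  refine (Finset.abs_sum_le_sum_abs _ _).trans ?_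
  rw [Finset.sum_mul]
  refine Finset.sum_le_sum fun s hs' => ?_
  obtain ⟨h1, h2⟩ := hs s hs'
  rw [norm_zpow, Real.log_zpow, abs_mul, mul_assoc]
  gcongr
  have h3 : 1 ≤ ‖z - s‖ := by linarith
  rw [abs_of_nonneg (Real.log_nonneg h3)]
  have h4 := Real.log_le_rpow_div (norm_nonneg (z - s)) (show (0:ℝ) < 1/2 by norm_num)
  have h5 : ‖z - s‖ ^ (1/2 : ℝ) ≤ 2 * ‖z‖ ^ (1/2 : ℝ) := by
    calc ‖z - s‖ ^ (1/2 : ℝ) ≤ (4 * ‖z‖) ^ (1/2 : ℝ) := by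
          gcongr; linarith
      _ = 4 ^ (1/2 : ℝ) * ‖z‖ ^ (1/2 : ℝ) := Real.mul_rpow (by norm_num) hrp.le
      _ = _ := by
        congr 1
        rw [show (4:ℝ) = 2 ^ (2:ℝ) by norm_num, ← Real.rpow_mul (by norm_num)]
        norm_num
  linarith

/-- The symmetric weight. -/
noncomputable def s9V (z : ℂ) : ℝ := ‖z‖ ^ (7/2 : ℝ) * |z.im| ^ (-(7/4) : ℝ)

theorem s9V_nonneg (z : ℂ) : 0 ≤ s9V z := by unfold s9V; positivity

theorem s9V_ge {z : ℂ} (hy : z.im ≠ 0) (hr : 1 ≤ ‖z‖) : ‖z‖ ^ (1/2 : ℝ) ≤ s9V z := by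
  have hyp : 0 < |z.im| := abs_pos.2 hy
  have hyr : |z.im| ≤ ‖z‖ := Complex.abs_im_le_norm z
  have hzr : 0 < ‖z‖ := by linarith
  calc ‖z‖ ^ (1/2 : ℝ) ≤ ‖z‖ ^ (7/4 : ℝ) := Real.rpow_le_rpow_of_exponent_le hr (by norm_num)
      _ = ‖z‖ ^ (7/2 : ℝ) * ‖z‖ ^ (-(7/4) : ℝ) := by rw [← Real.rpow_add hzr]; norm_num
      _ ≤ s9V z := by
        unfold s9V
        have := Real.rpow_le_rpow_of_nonpos hyp hyr (show (-(7/4) : ℝ) ≤ 0 by norm_num)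
        gcongr

theorem s9_B_bound2 {φ : ℂ → ℂ} (h : s9Good φ) : ∃ E R : ℝ, 0 ≤ E ∧ 1 ≤ R ∧
    ∀ z : ℂ, z.im ≠ 0 → R < ‖z‖ → ∀ᶠ w in 𝓝[≠] z, |Real.log ‖s9B φ w‖| ≤ E * s9V w := by
  obtain ⟨E1, R1, hE1, hR1, h1⟩ := s9_B_bound h
  obtain ⟨E2, R2, hE2, hR2, h2⟩ := s9_B_bound h.tilde
  refine ⟨E1 + E2, R1 + R2, by positivity, by linarith, ?_⟩
  intro z hy hr
  rcases lt_or_gt_of_ne hy with hneg | hpos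
  · have h3 := h2 ((starRingEnd ℂ) z) (by simpa using hneg) (by rw [Complex.norm_conj]; linarith)
    have h4 := (s9_tend_conj z).eventually h3
    have hopen : ∀ᶠ w in 𝓝[≠] z, w.im < 0 :=
      nhdsWithin_le_nhds ((isOpen_lt Complex.continuous_im continuous_const).mem_nhds hneg)
    filter_upwards [h4, hopen] with w w1 w2
    rw [s9_mtilde_B] at w1
    have e : s9W ((starRingEnd ℂ) w) = s9V w := by
      simp [s9W, s9V, abs_of_neg w2]
    rw [e] at w1
    simp only [mtilde, Complex.conj_conj, Complex.norm_conj] at w1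
    have := s9V_nonneg w
    nlinarith
  · have h3 := h1 z hpos (by linarith)
    have hopen : ∀ᶠ w in 𝓝[≠] z, 0 < w.im :=
      nhdsWithin_le_nhds ((isOpen_lt continuous_const Complex.continuous_im).mem_nhds hpos)
    filter_upwards [h3, hopen] with w w1 w2
    have e : s9W w = s9V w := by
      simp [s9W, s9V, abs_of_pos w2]
    rw [e] at w1
    have := s9V_nonneg w
    nlinarith

theorem s9_factor {φ : ℂ → ℂ} (h : s9Good φ) : ∃ (S : Finset ℂ) (d : ℂ → ℤ) (k : ℂ → ℂ),
    Differentiable ℂ k ∧ (∀ s ∈ S, s.im ≠ 0) ∧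
    ∀ z, ∀ᶠ w in 𝓝[≠] z, s9B φ w / s9B (mtilde φ) w = (∏ s ∈ S, (w - s) ^ d s) * Complex.exp (k w) := by
  set K : ℂ → ℂ := s9B φ / s9B (mtilde φ) with hK
  have hKm : MeromorphicOn K Set.univ := fun z _ => (s9_B_mero h z).div (s9_B_mero h.tilde z)
  have hKne : ∀ z, meromorphicOrderAt K z ≠ ⊤ := by
    intro z
    rw [meromorphicOrderAt_ne_top_iff_eventually_ne_zero (hKm z (Set.mem_univ z))]
    filter_upwards [s9_B_ne h z, s9_B_ne h.tilde z] with w w1 w2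
    exact div_ne_zero w1 w2
  have hord : ∀ z, meromorphicOrderAt K z =
      meromorphicOrderAt (s9B φ) z - meromorphicOrderAt (s9B φ) ((starRingEnd ℂ) z) := by
    intro z
    rw [hK, meromorphicOrderAt_div (s9_B_mero h z) (s9_B_mero h.tilde z), s9_mtilde_B,
      s9_mtilde_order (s9_B_mero h _)]
  have hBne : ∀ z, meromorphicOrderAt (s9B φ) z ≠ ⊤ := fun z =>
    (meromorphicOrderAt_ne_top_iff_eventually_ne_zero (s9_B_mero h z)).2 (s9_B_ne h z)
  have hreal : ∀ z : ℂ, z.im = 0 → meromorphicOrderAt K z = 0 := by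
    intro z hz
    rw [hord, Complex.conj_eq_iff_im.2 hz]
    obtain ⟨n, hn⟩ := WithTop.ne_top_iff_exists.1 (hBne z)
    rw [← hn]
    norm_cast
    ring
  set T := {z : ℂ | z.im ≠ 0 ∧ (0 < meromorphicOrderAt φ z ∨ 0 < meromorphicOrderAt (deriv φ) z ∨
    0 < meromorphicOrderAt (deriv (deriv φ)) z)} with hT
  have hTfin : T.Finite := h.2.2.2.2
  have hBT : ∀ z : ℂ, z.im ≠ 0 → z ∉ T → meromorphicOrderAt (s9B φ) z = 0 := by
    intro z hz hzT
    have hns : ¬ (0 < meromorphicOrderAt φ z ∨ 0 < meromorphicOrderAt (deriv φ) z ∨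
          0 < meromorphicOrderAt (deriv (deriv φ)) z) := fun hc => hzT ⟨hz, hc⟩
    push Not at hns
    exact s9_B_order (h.1 z) hns.1 hns.2.1 hns.2.2
  have hsupp : (MeromorphicOn.divisor K Set.univ).support ⊆ T ∪ (starRingEnd ℂ) ⁻¹' T := by
    intro z hz
    by_contra hc
    rw [Set.mem_union, not_or] at hc
    apply hz
    rw [MeromorphicOn.divisor_apply hKm (Set.mem_univ z)]
    by_cases him : z.im = 0
    · rw [hreal z him]; rfl
    · rw [hord, hBT z him hc.1, hBT ((starRingEnd ℂ) z) (by simpa using him) hc.2]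
      simp
  have hfin : (MeromorphicOn.divisor K Set.univ).support.Finite :=
    (hTfin.union (hTfin.preimage ((starRingEnd ℂ).injective.injOn))).subset hsupp
  obtain ⟨g, hg, hg0, hKg⟩ := hKm.extract_zeros_poles (fun u => hKne u) hfin
  have hgd : Differentiable ℂ g := fun z => (hg z (Set.mem_univ z)).differentiableAt
  obtain ⟨k, hk, hkg⟩ := s9_exists_log_entire hgd (fun z => hg0 ⟨z, Set.mem_univ z⟩)
  refine ⟨hfin.toFinset, MeromorphicOn.divisor K Set.univ, k, hk, ?_, ?_⟩
  · intro s hs him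
    rw [Set.Finite.mem_toFinset] at hs
    apply hs
    rw [MeromorphicOn.divisor_apply hKm (Set.mem_univ s), hreal s him]
    rfl
  · intro z
    have h1 := mem_codiscreteWithin_iff_forall_mem_nhdsNE.1 hKg z (Set.mem_univ z)
    have h2 : ∀ᶠ w in 𝓝[≠] z, K w = ((∏ᶠ (u : ℂ), (fun x => x - u) ^ (MeromorphicOn.divisor K Set.univ) u) • g) w := by
      filter_upwards [h1] with w hw
      simpa using hw
    filter_upwards [h2] with w hw
    have hw' : s9B φ w / s9B (mtilde φ) w = K w := rfl
    rw [hw', hw, hkg, Pi.smul_apply', smul_eq_mul, Function.FactorizedRational.finprod_eq_fun hfin]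
    congr 1
    refine finprod_eq_prod_of_mulSupport_subset _ ?_
    intro s hs
    rw [Set.Finite.coe_toFinset]
    intro h0
    apply hs
    simp only [h0, zpow_zero]


/-! ### Part 11: the conclusion -/

theorem s9V_cont {z : ℂ} (hy : z.im ≠ 0) (hr : z ≠ 0) : ContinuousAt s9V z := by
  unfold s9V
  refine ContinuousAt.mul ?_ ?_
  · exact (continuous_norm.continuousAt).rpow_const (Or.inl (norm_ne_zero_iff.2 hr))
  · exact ((continuous_abs.comp Complex.continuous_im).continuousAt).rpow_const
      (Or.inl (abs_ne_zero.2 hy))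

theorem s9_k_affine {φ : ℂ → ℂ} (h : s9Good φ) {S : Finset ℂ} {d : ℂ → ℤ} {k : ℂ → ℂ}
    (hk : Differentiable ℂ k)
    (hK : ∀ z, ∀ᶠ w in 𝓝[≠] z, s9B φ w / s9B (mtilde φ) w =
      (∏ s ∈ S, (w - s) ^ d s) * Complex.exp (k w)) : ∃ a b : ℂ, ∀ z, k z = a * z + b := by
  obtain ⟨E1, R1, hE1, hR1, h1⟩ := s9_B_bound2 h
  obtain ⟨E2, R2, hE2, hR2, h2⟩ := s9_B_bound2 h.tilde
  obtain ⟨D, R3, hD, hR3, hS, h3⟩ := s9_rat_bound S d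
  refine s9_affine hk (C := E1 + E2 + D) (R := R1 + R2 + R3) (by positivity) (by linarith) ?_
  intro z hy hr
  have hz0 : z ≠ 0 := by
    rintro rfl
    simp at hy
  have hnorm : ∀ᶠ w in 𝓝[≠] z, R3 < ‖w‖ :=
    nhdsWithin_le_nhds ((isOpen_lt continuous_const continuous_norm).mem_nhds
      (show R3 < ‖z‖ by linarith))
  have him : ∀ᶠ w in 𝓝[≠] z, w.im ≠ 0 :=
    nhdsWithin_le_nhds ((isOpen_ne_fun Complex.continuous_im continuous_const).mem_nhds hy)
  have hev : ∀ᶠ w in 𝓝[≠] z, |(k w).re| ≤ (E1 + E2 + D) * s9V w := by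
    filter_upwards [hnorm, him, h1 z hy (by linarith), h2 z hy (by linarith), hK z, s9_B_ne h z,
      s9_B_ne h.tilde z] with w w1 w2 w3 w4 w5 w6 w7
    have p0 : (∏ s ∈ S, (w - s) ^ d s) ≠ 0 := by
      rw [Finset.prod_ne_zero_iff]
      intro s hs
      apply zpow_ne_zero
      rw [sub_ne_zero]
      rintro rfl
      linarith [hS w hs]
    have e := congrArg (fun x => Real.log ‖x‖) w5
    simp only [norm_div, norm_mul, Complex.norm_exp] at e
    rw [Real.log_div (norm_ne_zero_iff.2 w6) (norm_ne_zero_iff.2 w7),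
      Real.log_mul (norm_ne_zero_iff.2 p0) (Real.exp_pos _).ne', Real.log_exp] at e
    have b3 := h3 w w1.le
    have b4 := s9V_ge w2 (show 1 ≤ ‖w‖ by linarith)
    have b5 : D * ‖w‖ ^ (1/2 : ℝ) ≤ D * s9V w := by gcongr
    have e2 : (k w).re = Real.log ‖s9B φ w‖ - Real.log ‖s9B (mtilde φ) w‖ -
      Real.log ‖∏ s ∈ S, (w - s) ^ d s‖ := by linarith
    rw [abs_le] at w3 w4 b3 ⊢
    rw [e2]
    constructor <;> linarith [w3.1, w3.2, w4.1, w4.2, b3.1, b3.2]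
  have t1 : Tendsto (fun w => |(k w).re|) (𝓝[≠] z) (𝓝 |(k z).re|) :=
    ((continuous_abs.comp (Complex.continuous_re.comp hk.continuous)).tendsto z).mono_left
      nhdsWithin_le_nhds
  have t2 : Tendsto (fun w => (E1 + E2 + D) * s9V w) (𝓝[≠] z) (𝓝 ((E1 + E2 + D) * s9V z)) :=
    ((s9V_cont hy hz0).tendsto.mono_left nhdsWithin_le_nhds).const_mul _
  exact le_of_tendsto_of_tendsto t1 t2 hev

theorem s9_prod_analytic {S : Finset ℂ} (d : ℂ → ℤ) {z : ℂ} (hz : z ∉ S) :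
    AnalyticAt ℂ (fun w => ∏ s ∈ S, (w - s) ^ d s) z ∧ (∏ s ∈ S, (z - s) ^ d s) ≠ 0 := by
  have hne : ∀ s ∈ S, z - s ≠ 0 := by
    intro s hs
    rw [sub_ne_zero]
    rintro rfl
    exact hz hs
  constructor
  · refine Finset.analyticAt_fun_prod S fun s hs => ?_
    exact (analyticAt_id.sub analyticAt_const).fun_zpow (hne s hs)
  · rw [Finset.prod_ne_zero_iff]
    exact fun s hs => zpow_ne_zero _ (hne s hs)

theorem s9_prod_mero (S : Finset ℂ) (d : ℂ → ℤ) (z : ℂ) :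
    MeromorphicAt (fun w => ∏ s ∈ S, (w - s) ^ d s) z := by
  induction S using Finset.induction_on with
  | empty => simpa using MeromorphicAt.const (1:ℂ) z
  | insert a S ha ih =>
    have e : (fun w : ℂ => ∏ s ∈ insert a S, (w - s) ^ d s) =
        fun w => (w - a) ^ d a * ∏ s ∈ S, (w - s) ^ d s := by
      funext w; rw [Finset.prod_insert ha]
    rw [e]
    exact (((MeromorphicAt.id z).sub (MeromorphicAt.const a z)).zpow (d a)).mul ih

theorem s9_norm_real {φ : ℂ → ℂ} (h : s9Good φ) {S : Finset ℂ} {d : ℂ → ℤ} {k : ℂ → ℂ}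
    (hk : Differentiable ℂ k) (hS : ∀ s ∈ S, s.im ≠ 0)
    (hK : ∀ z, ∀ᶠ w in 𝓝[≠] z, s9B φ w / s9B (mtilde φ) w =
      (∏ s ∈ S, (w - s) ^ d s) * Complex.exp (k w)) (x : ℝ) :
    ‖(∏ s ∈ S, ((x:ℂ) - s) ^ d s) * Complex.exp (k x)‖ = 1 := by
  have hx : (x:ℂ) ∉ S := fun hc => hS _ hc (Complex.ofReal_im x)
  have hc : ContinuousAt (fun w : ℂ => ‖(∏ s ∈ S, (w - s) ^ d s) * Complex.exp (k w)‖) (x:ℂ) :=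
    ((s9_prod_analytic d hx).1.continuousAt.mul
      (Complex.continuous_exp.comp hk.continuous).continuousAt).norm
  have htend : Tendsto (fun t : ℝ => (t:ℂ)) (𝓝[≠] x) (𝓝[≠] (x:ℂ)) := by
    refine tendsto_nhdsWithin_iff.2 ⟨(Complex.continuous_ofReal.tendsto x).mono_left
      nhdsWithin_le_nhds, ?_⟩
    filter_upwards [self_mem_nhdsWithin] with t ht
    intro hc
    exact ht (Complex.ofReal_injective hc)
  have t1 : Tendsto (fun t : ℝ => ‖(∏ s ∈ S, ((t:ℂ) - s) ^ d s) * Complex.exp (k t)‖) (𝓝[≠] x)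
      (𝓝 ‖(∏ s ∈ S, ((x:ℂ) - s) ^ d s) * Complex.exp (k x)‖) :=
    (hc.tendsto.mono_left nhdsWithin_le_nhds).comp htend
  have t2 : Tendsto (fun t : ℝ => ‖(∏ s ∈ S, ((t:ℂ) - s) ^ d s) * Complex.exp (k t)‖) (𝓝[≠] x)
      (𝓝 1) := by
    refine tendsto_const_nhds.congr' ?_
    filter_upwards [htend.eventually (hK x), htend.eventually (s9_B_ne h x)] with t t1 t2
    rw [← t1, s9_mtilde_B]
    simp only [mtilde, Complex.conj_ofReal, norm_div, Complex.norm_conj]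
    exact (div_self (norm_ne_zero_iff.2 t2)).symm
  exact tendsto_nhds_unique t1 t2

theorem s9_re_zero {S : Finset ℂ} {d : ℂ → ℤ} {a b : ℂ}
    (hS : ∀ s ∈ S, s.im ≠ 0)
    (h1 : ∀ x : ℝ, ‖(∏ s ∈ S, ((x:ℂ) - s) ^ d s) * Complex.exp (a * x + b)‖ = 1) : a.re = 0 := by
  obtain ⟨D, R, hD, hR, -, h3⟩ := s9_rat_bound S d
  have key : ∀ x : ℝ, R ≤ x → |a.re| ≤ D * x ^ (-(1/2) : ℝ) + |b.re| * x⁻¹ := by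
    intro x hx
    have hx0 : 0 < x := by linarith
    have hn : ‖(x:ℂ)‖ = x := by rw [Complex.norm_real, Real.norm_of_nonneg hx0.le]
    have b3 := h3 x (by rw [hn]; exact hx)
    rw [hn] at b3
    have hxS : (x:ℂ) ∉ S := fun hc => hS _ hc (Complex.ofReal_im x)
    have p0 := (s9_prod_analytic d hxS).2
    have e := congrArg Real.log (h1 x)
    rw [norm_mul, Complex.norm_exp, Real.log_mul (norm_ne_zero_iff.2 p0) (Real.exp_pos _).ne',
      Real.log_exp, Real.log_one] at e
    simp only [Complex.add_re, Complex.mul_re, Complex.ofReal_re, Complex.ofReal_im, mul_zero,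
      sub_zero] at e
    have e2 : |a.re| * x ≤ D * x ^ (1/2 : ℝ) + |b.re| := by
      rw [← abs_of_pos hx0, ← abs_mul, abs_of_pos hx0]
      have : a.re * x = - Real.log ‖∏ s ∈ S, ((x:ℂ) - s) ^ d s‖ - b.re := by linarith
      rw [this]
      refine (abs_sub _ _).trans ?_
      rw [abs_neg]
      linarith
    have e3 : x ^ (-(1/2) : ℝ) = x ^ (1/2 : ℝ) * x⁻¹ := by
      rw [← Real.rpow_neg_one x, ← Real.rpow_add hx0]; norm_num
    rw [e3]
    calc |a.re| = (|a.re| * x) * x⁻¹ := by field_simp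
      _ ≤ (D * x ^ (1/2 : ℝ) + |b.re|) * x⁻¹ := by gcongr
      _ = _ := by ring
  have t : Tendsto (fun x : ℝ => D * x ^ (-(1/2) : ℝ) + |b.re| * x⁻¹) atTop (𝓝 (D * 0 + |b.re| * 0)) :=
    ((tendsto_rpow_neg_atTop (by norm_num)).const_mul D).add (tendsto_inv_atTop_zero.const_mul _)
  have := ge_of_tendsto t (eventually_atTop.2 ⟨R, key⟩)
  simp only [mul_zero, add_zero] at this
  exact abs_eq_zero.1 (le_antisymm this (abs_nonneg _))

theorem s9_iter_mero {f : ℂ → ℂ} (hf : ∀ z, MeromorphicAt f z) (m : ℕ) (z : ℂ) :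
    MeromorphicAt (iteratedDeriv m f) z := by
  induction m generalizing z with
  | zero => simpa using hf z
  | succ n ih => rw [iteratedDeriv_succ]; exact (ih z).deriv

theorem s9_order_fin {g : ℂ → ℂ} (hg : ∀ z, MeromorphicAt g z)
    (hfin : {z : ℂ | 0 < meroOrder g z ∧ z.im ≠ 0}.Finite) (z : ℂ) : meromorphicOrderAt g z ≠ ⊤ := by
  intro htop
  have hall : ∀ w, meromorphicOrderAt g w = ⊤ := by
    intro w
    by_contra hw
    exact (MeromorphicOn.meromorphicOrderAt_ne_top_of_isPreconnected
      (U := Set.univ) (fun u _ => hg u) isPreconnected_univ (Set.mem_univ w) (Set.mem_univ z) hw) htop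
  have hinj : Set.InjOn (fun n : ℕ => ((n:ℂ) + Complex.I)) Set.univ := by
    intro p _ q _ hpq
    simpa using hpq
  refine (Set.infinite_univ.image hinj) (hfin.subset ?_)
  rintro _ ⟨n, -, rfl⟩
  refine ⟨?_, by simp⟩
  rw [meroOrder, dif_pos (hg _), hall]
  exact WithTop.coe_lt_top 0

theorem s9_good {M : ℕ} {f : ℂ → ℂ} (hs : Setup M f) {m : ℕ} (hm : m ≤ M + 1) :
    s9Good (iteratedDeriv m f) := by
  obtain ⟨-, hf, -, hfin⟩ := hs
  have e1 : deriv (iteratedDeriv m f) = iteratedDeriv (m + 1) f := iteratedDeriv_succ.symm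
  have e2 : deriv (iteratedDeriv (m + 1) f) = iteratedDeriv (m + 2) f := iteratedDeriv_succ.symm
  have hme := s9_iter_mero hf
  have hmo : ∀ j z, meroOrder (iteratedDeriv j f) z = meromorphicOrderAt (iteratedDeriv j f) z :=
    fun j z => dif_pos (hme j z)
  refine ⟨hme m, s9_order_fin (hme m) (hfin m (by omega)), ?_, ?_, ?_⟩
  · rw [e1]; exact s9_order_fin (hme _) (hfin _ (by omega))
  · rw [e1, e2]; exact s9_order_fin (hme _) (hfin _ (by omega))
  · rw [e1, e2]
    refine (((hfin m (by omega)).union (hfin (m + 1) (by omega))).union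
      (hfin (m + 2) (by omega))).subset ?_
    rintro z ⟨hz, h⟩
    simp only [Set.mem_union, Set.mem_setOf_eq, hmo]
    tauto

theorem s9_deriv_F {φ : ℂ → ℂ} (h : s9Good φ) (z : ℂ) :
    ∀ᶠ w in 𝓝[≠] z, deriv (fun w => w - φ w / deriv φ w) w = s9B φ w := by
  filter_upwards [s9_hasDeriv h z] with w hw
  have := ((hasDerivAt_id w).sub hw).deriv
  simp only [sub_sub_cancel] at this
  exact this

theorem s9_nonconst {φ : ℂ → ℂ} (h : s9Good φ) :
    ¬ ∃ c : ℂ, MeroEq (fun w => w - φ w / deriv φ w) (fun _ => c) := by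
  rintro ⟨c, hc⟩
  have h0 := s9_nhdsNE_deriv (z := 0) (f := fun w => w - φ w / deriv φ w) (g := fun _ => c) (hc 0)
  have hf : ∀ᶠ w in 𝓝[≠] (0:ℂ), False := by
    filter_upwards [h0, s9_deriv_F h 0, s9_B_ne h 0] with w w1 w2 w3
    rw [w2] at w1
    simp at w1
    exact w3 w1
  exact hf.exists.elim fun _ hx => hx

theorem s9_main {φ : ℂ → ℂ} (h : s9Good φ) : ∃ Km : ℂ → ℂ,
    (∀ z, MeromorphicAt Km z) ∧ {z | 0 < meroOrder Km z}.Finite ∧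
    {z | meroOrder Km z < 0}.Finite ∧
    MeroEq (s9B φ) (fun z => Km z * s9B (mtilde φ) z) ∧
    (∀ x : ℝ, ‖Km (x : ℂ)‖ = 1) ∧
      ∃ (Rm : ℂ → ℂ) (am : ℝ), IsRatFn Rm ∧
        MeroEq Km (fun z => Rm z * Complex.exp (Complex.I * (am : ℂ) * z)) := by
  obtain ⟨S, d, k, hk, hS, hK⟩ := s9_factor h
  obtain ⟨a, b, hab⟩ := s9_k_affine h hk hK
  have hn := s9_norm_real h hk hS hK
  have ha : a.re = 0 := by
    refine s9_re_zero (S := S) (d := d) (a := a) (b := b) hS fun x => ?_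
    rw [← hab]; exact hn x
  have han : ∀ z, AnalyticAt ℂ (fun z => Complex.exp (k z)) z := fun z =>
    (Complex.differentiable_exp.comp hk).analyticAt z
  have hme : ∀ z, MeromorphicAt (fun z => (∏ s ∈ S, (z - s) ^ d s) * Complex.exp (k z)) z :=
    fun z => (s9_prod_mero S d z).mul (han z).meromorphicAt
  have hzero : ∀ z, z ∉ S →
      meroOrder (fun z => (∏ s ∈ S, (z - s) ^ d s) * Complex.exp (k z)) z = 0 := by
    intro z hz
    rw [meroOrder, dif_pos (hme z)]
    obtain ⟨p1, p2⟩ := s9_prod_analytic d hz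
    have p3 : AnalyticAt ℂ (fun z => (∏ s ∈ S, (z - s) ^ d s) * Complex.exp (k z)) z := p1.mul (han z)
    exact p3.meromorphicNFAt.meromorphicOrderAt_eq_zero_iff.2 (mul_ne_zero p2 (Complex.exp_ne_zero _))
  refine ⟨fun z => (∏ s ∈ S, (z - s) ^ d s) * Complex.exp (k z), hme, ?_, ?_, ?_, hn,
    fun z => Complex.exp b * ∏ s ∈ S, (z - s) ^ d s, a.im, s9_isRat S d _, ?_⟩
  · refine S.finite_toSet.subset fun z hz => ?_
    by_contra hc
    rw [Set.mem_setOf_eq, hzero z hc] at hz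
    exact lt_irrefl _ hz
  · refine S.finite_toSet.subset fun z hz => ?_
    by_contra hc
    rw [Set.mem_setOf_eq, hzero z hc] at hz
    exact lt_irrefl _ hz
  · intro z
    filter_upwards [hK z, s9_B_ne h.tilde z] with w w1 w2
    rw [← w1, div_mul_cancel₀ _ w2]
  · intro z
    refine Eventually.of_forall fun w => ?_
    have hai : a = Complex.I * (a.im : ℂ) := by
      apply Complex.ext <;> simp [ha]
    simp only
    rw [hab, Complex.exp_add, ← hai]
    ring

/-- Lemma 3.1 of the paper: under the Setup, for `0 ≤ m ≤ M+1`, the functions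
`F_m` and `G_m` are non-constant and there is a meromorphic `K_m` with finitely many zeros
and poles with `F_m' = f^(m) f^(m+2)/(f^(m+1))^2 = K_m G_m'`, `|K_m| = 1` on the real axis,
and `K_m(z) = R_m(z) exp(i a_m z)` with `R_m` rational and `a_m` real. -/
theorem statement_9 (M : ℕ) (f : ℂ → ℂ) (hs : Setup M f) (m : ℕ) (hm : m ≤ M + 1) :
    (¬ ∃ c : ℂ, MeroEq (Fm f m) (fun _ => c)) ∧
    (¬ ∃ c : ℂ, MeroEq (Fm (mtilde f) m) (fun _ => c)) ∧
    ∃ Km : ℂ → ℂ, IsKm f m Km ∧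
      MeroEq (deriv (Fm f m)) (fun z =>
        iteratedDeriv m f z * iteratedDeriv (m + 2) f z / (iteratedDeriv (m + 1) f z) ^ 2) ∧
      (∀ x : ℝ, ‖Km (x : ℂ)‖ = 1) ∧
      ∃ (Rm : ℂ → ℂ) (am : ℝ), IsRatFn Rm ∧
        MeroEq Km (fun z => Rm z * Complex.exp (Complex.I * (am : ℂ) * z)) := by
  have h := s9_good hs hm
  have eF : ∀ g : ℂ → ℂ, Fm g m =
      fun w => w - iteratedDeriv m g w / deriv (iteratedDeriv m g) w := by
    intro g
    rw [← iteratedDeriv_succ]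
    rfl
  have ht : iteratedDeriv m (mtilde f) = mtilde (iteratedDeriv m f) := s9_mtilde_iteratedDeriv f m
  have eB : s9B (iteratedDeriv m f) = fun z =>
      iteratedDeriv m f z * iteratedDeriv (m + 2) f z / (iteratedDeriv (m + 1) f z) ^ 2 := by
    unfold s9B
    rw [← iteratedDeriv_succ, ← iteratedDeriv_succ]
  obtain ⟨Km, k1, k2, k3, k4, k5, k6⟩ := s9_main h
  refine ⟨?_, ?_, Km, ⟨k1, k2, k3, ?_⟩, ?_, k5, k6⟩
  · rw [eF]; exact s9_nonconst h
  · rw [eF, ht]; exact s9_nonconst h.tilde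
  · intro z
    rw [eF, eF, ht]
    filter_upwards [s9_deriv_F h z, s9_deriv_F h.tilde z, k4 z] with w w1 w2 w3
    rw [w1, w2, w3]
  · intro z
    rw [eF, ← eB]
    exact s9_deriv_F h z
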